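/- For every k ≥ 1: a language L ⊆ Σ* is Σ⁰_k if and only if L = L(M) for some Σ_k alternating Turing machine M, and L is Π⁰_k if and only if L = L(M) for some Π_k alternating Turing machine M. -/

import Mathlib

namespace ATMPaper

/-- Actions of a Turing machine: overwrite the scanned symbol by a letter,
move the cursor backward (`left`), or forward (`right`). -/
inductive Act (Γ : Type) : Type
  | write : Γ → Act Γ
  | left : Act Γ
  | right : Act Γ

/-- A cursored tape `u γ̲ v`: the string `u` to the left of the cursor,
the scanned symbol `γ`, and the string `v` to the right. -/
abbrev Tape (Γ : Type) : Type := List Γ × Γ × List Γ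

/-- The scanned symbol of a cursored tape. -/
def Tape.scan {Γ : Type} (t : Tape Γ) : Γ := t.2.1

/-- The effect of an action on a cursored tape (with blank symbol `blank`):
moving forward past the right end extends the tape with a blank, and moving
backward at the left end leaves the cursor in place. -/
inductive ActStep {Γ : Type} (blank : Γ) : Act Γ → Tape Γ → Tape Γ → Prop
  | fwd (u : List Γ) (γ τ : Γ) (v : List Γ) :
      ActStep blank Act.right (u, γ, τ :: v) (u ++ [γ], τ, v)
  | fwdEnd (u : List Γ) (γ : Γ) :
      ActStep blank Act.right (u, γ, []) (u ++ [γ], blank, [])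
  | bwd (u : List Γ) (τ γ : Γ) (v : List Γ) :
      ActStep blank Act.left (u ++ [τ], γ, v) (u, τ, γ :: v)
  | bwdEnd (γ : Γ) (v : List Γ) :
      ActStep blank Act.left ([], γ, v) ([], γ, v)
  | write (u : List Γ) (γ τ : Γ) (v : List Γ) :
      ActStep blank (Act.write τ) (u, γ, v) (u, τ, v)

section Generic

variable {C : Type*} (isE : C → Bool) (step : C → C → Prop)

/-- A chain of steps `c = c₀ → ⋯ → cₙ = c'` (`n ≥ 0`) in which `c₀,…,cₙ₋₁`
are all existential. -/
inductive EChain : C → C → Prop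
  | refl (c : C) : EChain c c
  | step {c c' c'' : C} : isE c = true → step c c' → EChain c' c'' → EChain c c''

/-- A chain of steps `c = c₀ → ⋯ → cₙ = c'` (`n ≥ 0`) in which `c₀,…,cₙ₋₁`
are all universal. -/
inductive UChain : C → C → Prop
  | refl (c : C) : UChain c c
  | step {c c' c'' : C} : isE c = false → step c c' → UChain c' c'' → UChain c c''

/-- `c ⇑∃ c'` : `c'` is universal and reachable from `c` by a chain passing
only through existential configurations. -/
def EPivot (c c' : C) : Prop := EChain isE step c c' ∧ isE c' = false

/-- `c ⇑∀ c'` : `c'` is existential and reachable from `c` by a chain passing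
only through universal configurations. -/
def UPivot (c c' : C) : Prop := UChain isE step c c' ∧ isE c' = true

/-- The set `AC` of accepted configurations: the least set `S` such that
(i) an existential `c` with some pivot `c ⇑∃ c'`, `c' ∈ S`, is in `S`, and
(ii) a universal `c` all of whose pivots `c ⇑∀ c'` lie in `S` is in `S`. -/
inductive Accepted : C → Prop
  | ex {c c' : C} : isE c = true → EPivot isE step c c' → Accepted c' → Accepted c
  | univ {c : C} : isE c = false → (∀ c', UPivot isE step c c' → Accepted c') →
      Accepted c

/-- The set `RC` of rejected configurations: the least set `S` such that
(i) an existential `c` all of whose pivots `c ⇑∃ c'` lie in `S` is in `S`, and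
(ii) a universal `c` with some pivot `c ⇑∀ c'`, `c' ∈ S`, is in `S`. -/
inductive Rejected : C → Prop
  | ex {c : C} : isE c = true → (∀ c', EPivot isE step c c' → Rejected c') →
      Rejected c
  | univ {c c' : C} : isE c = false → UPivot isE step c c' → Rejected c' →
      Rejected c

end Generic

/-- An alternating Turing machine over input alphabet `α`, with (finite)
machine alphabet `Γ` into which `α` embeds, a blank symbol (not a letter
of `α`), a finite set `Q` of states each of which is existential
(`isE q = true`) or universal (`isE q = false`), a start state, and a
transition relation `δ`. -/
structure ATM (α Γ : Type) where
  ΓFin : Finite Γ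
  emb : α ↪ Γ
  blank : Γ
  blank_ne : ∀ a : α, emb a ≠ blank
  Q : Type
  QFin : Finite Q
  isE : Q → Bool
  start : Q
  δ : Q → Γ → Act Γ → Q → Prop

namespace ATM

variable {α Γ : Type} (M : ATM α Γ)

/-- A configuration: a state together with a cursored tape. -/
abbrev Cfg : Type := M.Q × Tape Γ

/-- A configuration is existential or universal according to its state. -/
def cfgE (c : M.Cfg) : Bool := M.isE c.1

/-- The one-step yield relation between configurations. -/
def Yield (c c' : M.Cfg) : Prop :=
  ∃ a : Act Γ, M.δ c.1 (Tape.scan c.2) a c'.1 ∧ ActStep M.blank a c.2 c'.2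

/-- `c ⇑∃ c'` for configurations of `M`. -/
def EPiv (c c' : M.Cfg) : Prop := ATMPaper.EPivot M.cfgE M.Yield c c'

/-- `c ⇑∀ c'` for configurations of `M`. -/
def UPiv (c c' : M.Cfg) : Prop := ATMPaper.UPivot M.cfgE M.Yield c c'

/-- `c` is an accepted configuration of `M`. -/
def Accepted (c : M.Cfg) : Prop := ATMPaper.Accepted M.cfgE M.Yield c

/-- `c` is a rejected configuration of `M`. -/
def Rejected (c : M.Cfg) : Prop := ATMPaper.Rejected M.cfgE M.Yield c

/-- The initial configuration `(s₀, ε, ⊔, w)` for input `w`. -/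
def init (w : List α) : M.Cfg := (M.start, ([], M.blank, w.map M.emb))

/-- `M` accepts the input string `w`. -/
def Accepts (w : List α) : Prop := M.Accepted (M.init w)

/-- `M` rejects the input string `w`. -/
def Rejects (w : List α) : Prop := M.Rejected (M.init w)

/-- The language `L(M)` accepted by `M`. -/
def Lang : Set (List α) := {w | M.Accepts w}

/-- The language `L̄(M)` rejected by `M`. -/
def coLang : Set (List α) := {w | M.Rejects w}

/-- `M` is total: every input is either accepted or rejected. -/
def Total : Prop := ∀ w : List α, M.Accepts w ∨ M.Rejects w

/-- `M` is one-sided: it has no accepted configurations, or no rejected ones. -/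
def OneSided : Prop :=
  (∀ c : M.Cfg, ¬ M.Accepted c) ∨ (∀ c : M.Cfg, ¬ M.Rejected c)

/-- The dual machine: same data, with existential and universal states
interchanged. -/
def dual : ATM α Γ :=
  ⟨M.ΓFin, M.emb, M.blank, M.blank_ne, M.Q, M.QFin,
    fun q => !M.isE q, M.start, M.δ⟩

/-- `M` is alternation well-founded: for no input `w` is there an infinite
sequence of yield-steps from the initial configuration for `w` in which the
type (existential/universal) changes infinitely often. -/
def AltWF : Prop :=
  ∀ w : List α, ¬∃ d : ℕ → M.Cfg, d 0 = M.init w ∧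
    (∀ i : ℕ, M.Yield (d i) (d (i + 1))) ∧
    (∀ n : ℕ, ∃ m : ℕ, n ≤ m ∧ M.cfgE (d m) ≠ M.cfgE (d (m + 1)))

/-- Every chain of yield-steps from an initial configuration of `M` has at
most `k` alternation-pivots, i.e. at most `k` indices at which the type of
the configuration changes. -/
def AltBound (k : ℕ) : Prop :=
  ∀ (w : List α) (n : ℕ) (d : ℕ → M.Cfg), d 0 = M.init w →
    (∀ i < n, M.Yield (d i) (d (i + 1))) →
    ((Finset.range n).filter fun i => M.cfgE (d i) ≠ M.cfgE (d (i + 1))).card ≤ k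

/-- `M` is a `Σ_k` machine: its start state is existential and every chain of
yield-steps from an initial configuration has at most `k` alternation-pivots. -/
def IsSigmaM (k : ℕ) : Prop := M.isE M.start = true ∧ M.AltBound k

/-- `M` is a `Π_k` machine: its start state is universal and every chain of
yield-steps from an initial configuration has at most `k` alternation-pivots;
moreover for `k = 1` no transition rule applies to any existential state. -/
def IsPiM (k : ℕ) : Prop :=
  M.isE M.start = false ∧ M.AltBound k ∧
    (k = 1 → ∀ (q : M.Q) (γ : Γ) (a : Act Γ) (q' : M.Q),
      M.δ q γ a q' → M.isE q = false)

end ATM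

/-- `AltQuant α k b P` is the statement `Q₁ x₁ Q₂ x₂ ⋯ Q_k x_k, P (x₁,…,x_k)`
where the quantifiers `Qᵢ` over `List α` alternate, starting with `∃` if
`b = true` and with `∀` if `b = false`. -/
def AltQuant (α : Type) : (k : ℕ) → Bool → ((Fin k → List α) → Prop) → Prop
  | 0, _, P => P fun i => i.elim0
  | k + 1, true, P => ∃ x : List α, AltQuant α k false fun v => P (Fin.cons x v)
  | k + 1, false, P => ∀ x : List α, AltQuant α k true fun v => P (Fin.cons x v)

/-- `L ⊆ Σ*` is `Σ⁰_k`: definable by `k` alternating quantifiers over strings,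
beginning with `∃`, applied to a computable relation. -/
def IsSigma0 (α : Type) [Primcodable α] (k : ℕ) (L : Set (List α)) : Prop :=
  ∃ R : List α × (Fin k → List α) → Prop, ComputablePred R ∧
    L = {w | AltQuant α k true fun v => R (w, v)}

/-- `L ⊆ Σ*` is `Π⁰_k`: definable by `k` alternating quantifiers over strings,
beginning with `∀`, applied to a computable relation. -/
def IsPi0 (α : Type) [Primcodable α] (k : ℕ) (L : Set (List α)) : Prop :=
  ∃ R : List α × (Fin k → List α) → Prop, ComputablePred R ∧
    L = {w | AltQuant α k false fun v => R (w, v)}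

/-- `L ⊆ Σ*` is inductive (`Π¹₁`): there is a computable relation
`R ⊆ Σ* × List (Σ*)` with
`L = {w | ∀ f : ℕ → Σ*, ∃ n, R (w, [f 0, …, f n])}`. -/
def IsInductive (α : Type) [Primcodable α] (L : Set (List α)) : Prop :=
  ∃ R : List α × List (List α) → Prop, ComputablePred R ∧
    L = {w | ∀ f : ℕ → List α, ∃ n : ℕ, R (w, (List.range (n + 1)).map f)}

/-- A two-tape alternating Turing machine: as `ATM`, but configurations carry
two cursored tapes, and transitions read both scanned symbols and perform an
action on each tape. -/
structure ATM2 (α Γ : Type) where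
  ΓFin : Finite Γ
  emb : α ↪ Γ
  blank : Γ
  blank_ne : ∀ a : α, emb a ≠ blank
  Q : Type
  QFin : Finite Q
  isE : Q → Bool
  start : Q
  δ : Q → Γ → Γ → Act Γ → Act Γ → Q → Prop

namespace ATM2

variable {α Γ : Type} (M : ATM2 α Γ)

/-- A configuration of a two-tape machine: a state and two cursored tapes. -/
abbrev Cfg : Type := M.Q × Tape Γ × Tape Γ

/-- A configuration is existential or universal according to its state. -/
def cfgE (c : M.Cfg) : Bool := M.isE c.1

/-- The one-step yield relation of a two-tape machine. -/
def Yield (c c' : M.Cfg) : Prop :=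
  ∃ a₀ a₁ : Act Γ, M.δ c.1 (Tape.scan c.2.1) (Tape.scan c.2.2) a₀ a₁ c'.1 ∧
    ActStep M.blank a₀ c.2.1 c'.2.1 ∧ ActStep M.blank a₁ c.2.2 c'.2.2

/-- `c ⇑∃ c'` for configurations of `M`. -/
def EPiv (c c' : M.Cfg) : Prop := ATMPaper.EPivot M.cfgE M.Yield c c'

/-- `c ⇑∀ c'` for configurations of `M`. -/
def UPiv (c c' : M.Cfg) : Prop := ATMPaper.UPivot M.cfgE M.Yield c c'

/-- `c` is an accepted configuration of `M`. -/
def Accepted (c : M.Cfg) : Prop := ATMPaper.Accepted M.cfgE M.Yield c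

/-- `c` is a rejected configuration of `M`. -/
def Rejected (c : M.Cfg) : Prop := ATMPaper.Rejected M.cfgE M.Yield c

/-- `M` accepts `w`: the configuration reached after the (deterministic)
pre-processing phase — the start state with the input copied onto both
tapes — is accepted. -/
def Accepts (w : List α) : Prop :=
  M.Accepted (M.start, ([], M.blank, w.map M.emb), ([], M.blank, w.map M.emb))

/-- `M` rejects `w`. -/
def Rejects (w : List α) : Prop :=
  M.Rejected (M.start, ([], M.blank, w.map M.emb), ([], M.blank, w.map M.emb))

end ATM2

/-- The combined two-tape machine `M` of two single-tape machines `M₀`, `M₁`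
over a common alphabet. Its states are triples `⟨q₀,q₁,j⟩` (`j : Bool`, with
`false` for `0` and `true` for `1`), typed according to `q_j`. In control
`j = 0`, a rule `(q₀,γ₀,a,p₀)` of `M₀` acts by `a` on tape `0`, leaves tape `1`
unchanged (re-writing its scanned symbol), and passes to control `0` if `q₀`
and `p₀` are both universal, and to control `1` otherwise; symmetrically, in
control `j = 1`, a rule `(q₁,γ₁,a,p₁)` of `M₁` acts by `a` on tape `1`, leaves
tape `0` unchanged, and passes to control `1` if `q₁` and `p₁` are both
existential, and to control `0` otherwise. -/
def combine {α Γ : Type} (M₀ M₁ : ATM α Γ) : ATM2 α Γ where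
  ΓFin := M₀.ΓFin
  emb := M₀.emb
  blank := M₀.blank
  blank_ne := M₀.blank_ne
  Q := M₀.Q × M₁.Q × Bool
  QFin := by haveI := M₀.QFin; haveI := M₁.QFin; infer_instance
  isE := fun s => cond s.2.2 (M₁.isE s.2.1) (M₀.isE s.1)
  start := (M₀.start, M₁.start, false)
  δ := fun s γ₀ γ₁ a₀ a₁ p =>
    (s.2.2 = false ∧ ∃ p₀ : M₀.Q, M₀.δ s.1 γ₀ a₀ p₀ ∧ a₁ = Act.write γ₁ ∧
        p = (p₀, s.2.1, !(!(M₀.isE s.1) && !(M₀.isE p₀)))) ∨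
    (s.2.2 = true ∧ ∃ p₁ : M₁.Q, M₁.δ s.2.1 γ₁ a₁ p₁ ∧ a₀ = Act.write γ₀ ∧
        p = (s.1, p₁, M₁.isE s.2.1 && M₁.isE p₁))

section Generic

variable {C D : Type*}

/-- A chain of steps in which all configurations but possibly the last have type `b`. -/
def TChain (isE : C → Bool) (step : C → C → Prop) (b : Bool) : C → C → Prop :=
  Relation.ReflTransGen fun c d => isE c = b ∧ step c d

/-- A chain of steps through configurations of type `b` ending in one of the opposite type. -/
def TPivot (isE : C → Bool) (step : C → C → Prop) (b : Bool) (c c' : C) : Prop :=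
  TChain isE step b c c' ∧ isE c' = !b

variable {isE : C → Bool} {step : C → C → Prop}

theorem eChain_iff {c c' : C} : EChain isE step c c' ↔ TChain isE step true c c' := by
  constructor
  · intro h
    induction h with
    | refl c => exact .refl
    | step h1 h2 _ ih => exact .head ⟨h1, h2⟩ ih
  · intro h
    induction h using Relation.ReflTransGen.head_induction_on with
    | refl => exact .refl _
    | head h _ ih => exact .step h.1 h.2 ih

theorem uChain_iff {c c' : C} : UChain isE step c c' ↔ TChain isE step false c c' := by
  constructor
  · intro h
    induction h with
    | refl c => exact .refl
    | step h1 h2 _ ih => exact .head ⟨h1, h2⟩ ih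
  · intro h
    induction h using Relation.ReflTransGen.head_induction_on with
    | refl => exact .refl _
    | head h _ ih => exact .step h.1 h.2 ih

theorem ePivot_iff {c c' : C} : EPivot isE step c c' ↔ TPivot isE step true c c' := by
  simp [EPivot, TPivot, eChain_iff]

theorem uPivot_iff {c c' : C} : UPivot isE step c c' ↔ TPivot isE step false c c' := by
  simp [UPivot, TPivot, uChain_iff]

theorem accepted_of_true {c : C} (h : isE c = true) :
    Accepted isE step c ↔ ∃ c', TPivot isE step true c c' ∧ Accepted isE step c' := by
  constructor
  · rintro (⟨_, hp, ha⟩ | ⟨h', _⟩)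
    · exact ⟨_, ePivot_iff.1 hp, ha⟩
    · simp [h] at h'
  · rintro ⟨c', hp, ha⟩
    exact .ex h (ePivot_iff.2 hp) ha

theorem accepted_of_false {c : C} (h : isE c = false) :
    Accepted isE step c ↔ ∀ c', TPivot isE step false c c' → Accepted isE step c' := by
  constructor
  · rintro (⟨h', _, _⟩ | ⟨_, hp⟩)
    · simp [h] at h'
    · exact fun c' hc' => hp _ (uPivot_iff.2 hc')
  · intro hp
    exact .univ h fun e he => hp _ (uPivot_iff.1 he)

section Simulation

variable {eD : D → Bool} {sD : D → D → Prop} {B M : C → D → Prop}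

theorem TChain.simulate_forward
    (fwd : ∀ c c' d, step c c' → B c d → ∃ d', TChain eD sD (isE c) d d' ∧ B c' d')
    {b : Bool} {c c' : C} (h : TChain isE step b c c') {d : D} (hB : B c d) :
    ∃ d', TChain eD sD b d d' ∧ B c' d' := by
  induction h with
  | refl => exact ⟨d, .refl, hB⟩
  | tail _ hs ih =>
    obtain ⟨d1, h1, hB1⟩ := ih
    obtain ⟨d2, h2, hB2⟩ := fwd _ _ _ hs.2 hB1
    rw [hs.1] at h2
    exact ⟨d2, h1.trans h2, hB2⟩

theorem TPivot.simulate_backward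
    (hBM : ∀ c d, B c d → M c d) (hE : ∀ c d, M c d → eD d = isE c)
    (bwd : ∀ c d d', M c d → sD d d' → M c d' ∨ ∃ c', step c c' ∧ B c' d')
    {b : Bool} {d d' : D} (h : TPivot eD sD b d d') {c : C} (hM : M c d) (hb : isE c = b) :
    ∃ c', TPivot isE step b c c' ∧ B c' d' := by
  obtain ⟨h, hd'⟩ := h
  induction h using Relation.ReflTransGen.head_induction_on generalizing c with
  | refl => rw [hE _ _ hM, hb] at hd'; simp at hd'
  | @head d d1 hs hc ih =>
    rcases bwd _ _ _ hM hs.2 with h1 | ⟨c1, h1, hB1⟩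
    · exact ih h1 hb
    · by_cases hb1 : isE c1 = b
      · obtain ⟨c', hc', hB'⟩ := ih (hBM _ _ hB1) hb1
        exact ⟨c', ⟨.head ⟨hb, h1⟩ hc'.1, hc'.2⟩, hB'⟩
      · have : d1 = d' := by
          rcases Relation.ReflTransGen.cases_head hc with h | ⟨e, he, _⟩
          · exact h
          · exact absurd ((hE _ _ (hBM _ _ hB1)).symm.trans he.1) hb1
        subst this
        exact ⟨c1, ⟨.single ⟨hb, h1⟩, Bool.eq_not_of_ne hb1⟩, hB1⟩

/-- If `D` simulates `C` stepwise up to intermediate configurations, then related configurations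
are accepted simultaneously. -/
theorem accepted_iff_of_simulation
    (hBM : ∀ c d, B c d → M c d) (hE : ∀ c d, M c d → eD d = isE c)
    (fwd : ∀ c c' d, step c c' → B c d → ∃ d', TChain eD sD (isE c) d d' ∧ B c' d')
    (bwd : ∀ c d d', M c d → sD d d' → M c d' ∨ ∃ c', step c c' ∧ B c' d')
    {c : C} {d : D} (hB : B c d) : Accepted isE step c ↔ Accepted eD sD d := by
  have hE' : ∀ c d, B c d → eD d = isE c := fun c d h => hE _ _ (hBM _ _ h)
  constructor
  · intro h
    induction h generalizing d with
    | ex h hp _ ih =>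
      obtain ⟨d', hd', hB'⟩ := (ePivot_iff.1 hp).1.simulate_forward fwd hB
      rw [accepted_of_true ((hE' _ _ hB).trans h)]
      exact ⟨d', ⟨hd', (hE' _ _ hB').trans (ePivot_iff.1 hp).2⟩, ih hB'⟩
    | univ h hp ih =>
      rw [accepted_of_false ((hE' _ _ hB).trans h)]
      intro d' hd'
      obtain ⟨c', hc', hB'⟩ := hd'.simulate_backward hBM hE bwd (hBM _ _ hB) h
      exact ih c' (uPivot_iff.2 hc') hB'
  · intro h
    induction h generalizing c with
    | ex h hp _ ih =>
      have h' := (hE' _ _ hB).symm.trans h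
      obtain ⟨c', hc', hB'⟩ :=
        (ePivot_iff.1 hp).simulate_backward hBM hE bwd (hBM _ _ hB) h'
      rw [accepted_of_true h']
      exact ⟨c', hc', ih hB'⟩
    | univ h hp ih =>
      have h' := (hE' _ _ hB).symm.trans h
      rw [accepted_of_false h']
      intro c' hc'
      obtain ⟨d', hd', hB'⟩ := hc'.1.simulate_forward fwd hB
      exact ih d' (uPivot_iff.2 ⟨hd', (hE' _ _ hB').trans hc'.2⟩) hB'

end Simulation

/-- A potential that drops at every change of type bounds the number of such changes. -/
theorem card_alternations_le (pot : C → ℕ)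
    (hpot : ∀ c c', step c c' → pot c' + (if isE c ≠ isE c' then 1 else 0) ≤ pot c)
    (n : ℕ) (d : ℕ → C) (hd : ∀ i < n, step (d i) (d (i + 1))) :
    ((Finset.range n).filter fun i => isE (d i) ≠ isE (d (i + 1))).card ≤ pot (d 0) := by
  suffices h : ((Finset.range n).filter fun i => isE (d i) ≠ isE (d (i + 1))).card + pot (d n)
      ≤ pot (d 0) by omega
  induction n with
  | zero => simp
  | succ n ih =>
    have h1 := ih fun i hi => hd i (by omega)
    have h2 := hpot _ _ (hd n (by omega))
    rw [Finset.card_filter] at h1 ⊢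
    rw [Finset.sum_range_succ]
    omega

/-- At most `k` changes of type occur along any chain of steps from `c`. -/
def AltBoundFrom (isE : C → Bool) (step : C → C → Prop) (k : ℕ) (c : C) : Prop :=
  ∀ (n : ℕ) (d : ℕ → C), d 0 = c → (∀ i < n, step (d i) (d (i + 1))) →
    ((Finset.range n).filter fun i => isE (d i) ≠ isE (d (i + 1))).card ≤ k

theorem AltBoundFrom.of_step {k : ℕ} {c c' : C} (h : AltBoundFrom isE step k c) (hs : step c c') :
    AltBoundFrom isE step k c' := by
  intro n d hd0 hd
  have := h (n + 1) (fun i => i.casesOn c d) rfl (by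
    rintro (_ | i) hi
    · simpa [hd0] using hs
    · exact hd i (by omega))
  rw [Finset.card_filter, Finset.sum_range_succ'] at this
  rw [Finset.card_filter]
  exact le_trans (Nat.le_add_right _ _) this

theorem AltBoundFrom.of_step_of_ne {k : ℕ} {c c' : C} (h : AltBoundFrom isE step (k + 1) c)
    (hs : step c c') (hne : isE c ≠ isE c') : AltBoundFrom isE step k c' := by
  intro n d hd0 hd
  have := h (n + 1) (fun i => i.casesOn c d) rfl (by
    rintro (_ | i) hi
    · simpa [hd0] using hs
    · exact hd i (by omega))
  rw [Finset.card_filter, Finset.sum_range_succ'] at this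
  simp only [hd0] at this
  have h0 : (if isE ((fun i : ℕ => (i.casesOn c d : C)) 0) ≠ isE c' then 1 else 0) = 1 :=
    if_pos hne
  rw [Finset.card_filter]
  exact Nat.le_of_add_le_add_right (this.trans_eq (congrArg _ h0.symm))

theorem AltBoundFrom.pivot {k : ℕ} {b : Bool} {c c' : C}
    (h : AltBoundFrom isE step (k + 1) c) (hb : isE c = b) (hp : TPivot isE step b c c') :
    AltBoundFrom isE step k c' := by
  obtain ⟨hp, hc'⟩ := hp
  induction hp using Relation.ReflTransGen.head_induction_on with
  | refl => simp [hb] at hc'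
  | @head c c1 hs hc ih =>
    by_cases hb1 : isE c1 = b
    · exact ih (h.of_step hs.2) hb1
    · rcases Relation.ReflTransGen.cases_head hc with rfl | ⟨e, he, _⟩
      · exact h.of_step_of_ne hs.2 (by rw [hb]; exact Ne.symm hb1)
      · exact absurd he.1 hb1

theorem AltBoundFrom.not_pivot {b : Bool} {c c' : C}
    (h : AltBoundFrom isE step 0 c) (hb : isE c = b) : ¬ TPivot isE step b c c' := by
  rintro ⟨hp, hc'⟩
  induction hp using Relation.ReflTransGen.head_induction_on with
  | refl => simp [hb] at hc'
  | @head c c1 hs hc ih =>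
    by_cases hb1 : isE c1 = b
    · exact ih (h.of_step hs.2) hb1
    · have := h 1 (fun i => i.casesOn c fun _ => c1) rfl (by
        intro i hi
        obtain rfl : i = 0 := by omega
        exact hs.2)
      rw [Finset.card_filter, Finset.sum_range_one] at this
      have h0 : (if isE c ≠ isE c1 then 1 else 0) = 1 :=
        if_pos fun h => hb1 (h.symm.trans hs.1)
      exact absurd (h0.symm.trans_le this) (by decide)

end Generic
section TapeCells

variable {Γ : Type} {blank : Γ}

/-- The position of the cursor. -/
def Tape.pos (t : Tape Γ) : ℕ := t.1.length

/-- The content of cell `i`, blank beyond the right end. -/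
def Tape.cell (blank : Γ) (t : Tape Γ) (i : ℕ) : Γ := (t.1 ++ t.2.1 :: t.2.2).getD i blank

theorem Tape.cell_pos (t : Tape Γ) : t.cell blank t.pos = t.scan := by
  simp [Tape.cell, Tape.pos, Tape.scan]

theorem ActStep.pos_write {τ : Γ} {t t' : Tape Γ} (h : ActStep blank (.write τ) t t') :
    t'.pos = t.pos := by
  cases h; rfl

theorem ActStep.cell_write {τ : Γ} {t t' : Tape Γ} (h : ActStep blank (.write τ) t t') :
    t'.cell blank = Function.update (t.cell blank) t.pos τ := by
  cases h with
  | write u γ τ v =>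
    funext i
    simp only [Tape.cell, Tape.pos, Function.update_apply, List.getD_eq_getElem?_getD]
    split_ifs with h
    · simp [h]
    · rcases Nat.lt_or_gt_of_ne h with h | h
      · simp [List.getElem?_append_left h]
      · obtain ⟨j, hj⟩ : ∃ j, i - u.length = j + 1 := ⟨i - u.length - 1, by omega⟩
        simp [List.getElem?_append_right h.le, hj]

theorem ActStep.pos_right {t t' : Tape Γ} (h : ActStep blank .right t t') :
    t'.pos = t.pos + 1 := by
  cases h <;> simp [Tape.pos]

theorem ActStep.cell_right {t t' : Tape Γ} (h : ActStep blank .right t t') :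
    t'.cell blank = t.cell blank := by
  cases h with
  | fwd u γ τ v => funext i; simp [Tape.cell]
  | fwdEnd u γ =>
    funext i
    simp only [Tape.cell, List.getD_eq_getElem?_getD, List.append_assoc]
    grind

theorem ActStep.pos_left {t t' : Tape Γ} (h : ActStep blank .left t t') :
    t'.pos = t.pos - 1 := by
  cases h <;> simp [Tape.pos]

theorem ActStep.cell_left {t t' : Tape Γ} (h : ActStep blank .left t t') :
    t'.cell blank = t.cell blank := by
  cases h with
  | bwd u τ γ v => funext i; simp [Tape.cell]
  | bwdEnd γ v => rfl

theorem ActStep.exists (a : Act Γ) (t : Tape Γ) : ∃ t', ActStep blank a t t' := by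
  obtain ⟨u, γ, v⟩ := t
  cases a with
  | write τ => exact ⟨_, .write u γ τ v⟩
  | right =>
    cases v with
    | nil => exact ⟨_, .fwdEnd u γ⟩
    | cons τ v => exact ⟨_, .fwd u γ τ v⟩
  | left =>
    rcases List.eq_nil_or_concat' u with rfl | ⟨u, τ, rfl⟩
    · exact ⟨_, .bwdEnd γ v⟩
    · exact ⟨_, .bwd u τ γ v⟩

end TapeCells

/-- Operations on a family of stacks: pushing a letter, and testing that the top of a stack is
`o` (`none` if the stack is empty), popping it unless `keep = true`. -/
inductive SOp (K S : Type) : Type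
  | push (k : K) (s : S)
  | top (k : K) (o : Option S) (keep : Bool)

namespace SOp

variable {K S : Type}

instance [Finite K] [Finite S] : Finite (SOp K S) := by
  let f : SOp K S → (K × S) ⊕ (K × Option S × Bool) := fun
    | push k s => .inl (k, s)
    | top k o b => .inr (k, o, b)
  refine Finite.of_injective f ?_
  rintro (⟨k, s⟩ | ⟨k, o, b⟩) (⟨k', s'⟩ | ⟨k', o', b'⟩) h <;> simp_all [f]

/-- The stack on which an operation acts. -/
def stack : SOp K S → K
  | push k _ => k
  | top k _ _ => k

/-- The effect of an operation. -/
def Rel [DecidableEq K] : SOp K S → (K → List S) → (K → List S) → Prop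
  | push k s, T, T' => T' = Function.update T k (s :: T k)
  | top k o keep, T, T' =>
    (T k).head? = o ∧ T' = Function.update T k (if keep then T k else (T k).tail)

end SOp

/-- An alternating machine operating on a family of stacks. -/
structure ASM (K S : Type) where
  Q : Type
  isE : Q → Bool
  δ : Q → SOp K S → Q → Prop

namespace ASM

variable {K S : Type} (A : ASM K S)

/-- A configuration: a state and the contents of the stacks. -/
abbrev Cfg : Type := A.Q × (K → List S)

/-- A configuration is existential or universal according to its state. -/
def cfgE (c : A.Cfg) : Bool := A.isE c.1

/-- The one-step relation between configurations. -/
def Yield [DecidableEq K] (c d : A.Cfg) : Prop :=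
  ∃ o : SOp K S, A.δ c.1 o d.1 ∧ o.Rel c.2 d.2

/-- The transition rules. -/
abbrev Rule : Type := {r : A.Q × SOp K S × A.Q // A.δ r.1 r.2.1 r.2.2}

/-- The stages in the execution of a stack operation on a single tape. -/
inductive Phase
  | start | seek | edit | back

instance : Finite Phase :=
  Finite.of_injective
    (fun | .start => (0 : Fin 4) | .seek => 1 | .edit => 2 | .back => 3)
    (by rintro (_ | _ | _ | _) (_ | _ | _ | _) h <;> simp_all)

/-- The tape alphabet: a marker for the left end, and one track for each stack. -/
abbrev Cell (K S : Type) : Type := Bool × (K → Option S)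

/-- The content of cell `0`. -/
def marker : Cell K S := (true, fun _ => none)

/-- The transition rules of the Turing machine simulating a stack machine. -/
inductive TapeRule [DecidableEq K] :
    A.Q ⊕ (A.Rule × Phase) → Cell K S → Act (Cell K S) → A.Q ⊕ (A.Rule × Phase) → Prop
  | choose (r : A.Rule) (γ : Cell K S) :
      TapeRule (.inl r.1.1) γ (.write marker) (.inr (r, .start))
  | start (r : A.Rule) (γ : Cell K S) :
      TapeRule (.inr (r, .start)) γ .right (.inr (r, .seek))
  | seekRight (r : A.Rule) (γ : Cell K S) : γ.2 r.1.2.1.stack ≠ none →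
      TapeRule (.inr (r, .seek)) γ .right (.inr (r, .seek))
  | seekPush (r : A.Rule) (k : K) (s : S) (γ : Cell K S) : r.1.2.1 = .push k s → γ.2 k = none →
      TapeRule (.inr (r, .seek)) γ (.write (γ.1, Function.update γ.2 k (some s)))
        (.inr (r, .back))
  | seekTop (r : A.Rule) (k : K) (o : Option S) (b : Bool) (γ : Cell K S) :
      r.1.2.1 = .top k o b → γ.2 k = none →
      TapeRule (.inr (r, .seek)) γ .left (.inr (r, .edit))
  | edit (r : A.Rule) (k : K) (o : Option S) (b : Bool) (γ : Cell K S) :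
      r.1.2.1 = .top k o b → γ.2 k = o →
      TapeRule (.inr (r, .edit)) γ
        (.write (γ.1, Function.update γ.2 k (if b then o else none))) (.inr (r, .back))
  | backLeft (r : A.Rule) (γ : Cell K S) : γ.1 = false →
      TapeRule (.inr (r, .back)) γ .left (.inr (r, .back))
  | backDone (r : A.Rule) (γ : Cell K S) : γ.1 = true →
      TapeRule (.inr (r, .back)) γ (.write γ) (.inl r.1.2.2)

/-- The cell carrying the letter `s` on track `k` and nothing else. -/
def letterCell [DecidableEq K] (k : K) (s : S) : Cell K S :=
  (false, Function.update (fun _ => none) k (some s))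

theorem letterCell_snd_self [DecidableEq K] (k : K) (s : S) : (letterCell k s).2 k = some s :=
  by simp [letterCell]

theorem letterCell_snd_of_ne [DecidableEq K] {k k' : K} (h : k' ≠ k) (s : S) :
    (letterCell k s).2 k' = none :=
  by simp [letterCell, h]

/-- Cells from `1` on hold the stacks, bottom first. -/
def StackCells (T : K → List S) (f : ℕ → Cell K S) : Prop :=
  ∀ i, f (i + 1) = (false, fun k => (T k).reverse[i]?)

theorem StackCells.cell_length {T : K → List S} {f : ℕ → Cell K S} (h : StackCells T f)
    (h0 : f 0 = marker) (k : K) : (f (T k).length).2 k = (T k).head? := by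
  cases hT : T k with
  | nil => simp [h0, marker]
  | cons s l => simp [h _, hT]

theorem StackCells.push [DecidableEq K] {T : K → List S} {f : ℕ → Cell K S} (h : StackCells T f)
    (k : K) (s : S) :
    StackCells (Function.update T k (s :: T k))
      (Function.update f ((T k).length + 1)
        ((f ((T k).length + 1)).1, Function.update (f ((T k).length + 1)).2 k (some s))) := by
  intro i
  rw [Function.update_apply]
  split_ifs with hi
  · obtain rfl : i = (T k).length := by omega
    rw [h]
    refine Prod.ext rfl (funext fun k' => ?_)
    rcases eq_or_ne k' k with rfl | hk
    · simp
    · simp [hk]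
  · rw [h]
    refine Prod.ext rfl (funext fun k' => ?_)
    rcases eq_or_ne k' k with rfl | hk
    · simp only [Function.update_self, List.reverse_cons]
      grind
    · simp [hk]

theorem StackCells.top [DecidableEq K] {T : K → List S} {f : ℕ → Cell K S} (h : StackCells T f)
    (k : K) (b : Bool) :
    StackCells (Function.update T k (if b then T k else (T k).tail))
      (Function.update f (T k).length ((f (T k).length).1,
        Function.update (f (T k).length).2 k (if b then (T k).head? else none))) := by
  intro i
  rw [Function.update_apply]
  by_cases hi : i + 1 = (T k).length
  · rw [if_pos hi, ← hi, h]
    refine Prod.ext rfl (funext fun k' => ?_)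
    rcases eq_or_ne k' k with rfl | hk
    · simp only [Function.update_self]
      cases hT : T k' with
      | nil => simp [hT] at hi
      | cons s l =>
        obtain rfl : i = l.length := by simpa [hT] using hi
        cases b <;> simp
    · simp [hk]
  · rw [if_neg hi, h]
    refine Prod.ext rfl (funext fun k' => ?_)
    rcases eq_or_ne k' k with rfl | hk
    · simp only [Function.update_self]
      cases hT : T k' with
      | nil => simp
      | cons s l =>
        have hi : i ≠ l.length := by simpa [hT, Nat.succ_inj] using hi
        cases b <;> simp <;> grind
    · simp [hk]

variable [Finite K] [Finite S] [DecidableEq K] [Finite A.Q] {α : Type}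

/-- The Turing machine simulating a stack machine with initial state `q₀` and the input on
stack `inp`. -/
def toATM (q₀ : A.Q) (inp : K) (letter : α ↪ S) : ATM α (Cell K S) where
  ΓFin := inferInstance
  emb := ⟨fun a => letterCell inp (letter a), fun a b h => by
    have h : (letterCell inp (letter a)).2 inp = (letterCell inp (letter b)).2 inp :=
      congrFun (congrArg Prod.snd h) inp
    simpa [letterCell_snd_self] using h⟩
  blank := (false, fun _ => none)
  blank_ne a h := by
    have h : (letterCell inp (letter a)).2 inp = none := congrFun (congrArg Prod.snd h) inp
    simp [letterCell_snd_self] at h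
  Q := A.Q ⊕ (A.Rule × Phase)
  QFin := inferInstance
  isE := Sum.elim A.isE fun x => A.isE x.1.1.1
  start := .inl q₀
  δ := A.TapeRule

section Simulation

variable (q₀ : A.Q) (inp : K) (letter : α ↪ S)

/-- A configuration of the Turing machine representing one of the stack machine. -/
def Represents (c : A.Cfg) (d : (A.toATM q₀ inp letter).Cfg) : Prop :=
  d.1 = .inl c.1 ∧ d.2.pos = 0 ∧ StackCells c.2 (d.2.cell (false, fun _ => none))

/-- The invariant maintained while the Turing machine executes the stack operation `o`. -/
def Invariant (o : SOp K S) (T : K → List S) (t : Tape (Cell K S)) : Phase → Prop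
  | .start => t.pos = 0 ∧ StackCells T (t.cell (false, fun _ => none))
  | .seek => 1 ≤ t.pos ∧ t.pos ≤ (T o.stack).length + 1 ∧
      StackCells T (t.cell (false, fun _ => none))
  | .edit => t.pos = (T o.stack).length ∧ StackCells T (t.cell (false, fun _ => none))
  | .back => ∃ T', o.Rel T T' ∧ StackCells T' (t.cell (false, fun _ => none))

/-- A configuration of the Turing machine representing one of the stack machine, or reached in
the course of executing one of its rules. -/
def RepresentsMid (c : A.Cfg) (d : (A.toATM q₀ inp letter).Cfg) : Prop :=
  A.Represents q₀ inp letter c d ∨ ∃ (r : A.Rule) (ph : Phase), d.1 = .inr (r, ph) ∧ r.1.1 = c.1 ∧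
    d.2.cell (false, fun _ => none) 0 = marker ∧ Invariant r.1.2.1 c.2 d.2 ph

variable {A q₀ inp letter}

theorem RepresentsMid.cfgE {c : A.Cfg} {d : (A.toATM q₀ inp letter).Cfg}
    (h : A.RepresentsMid q₀ inp letter c d) :
    (A.toATM q₀ inp letter).cfgE d = A.cfgE c := by
  rcases h with h | ⟨r, ph, h, hr, _⟩
  · simp [ATM.cfgE, toATM, h.1, ASM.cfgE]
  · simp [ATM.cfgE, toATM, h, hr, ASM.cfgE]

theorem RepresentsMid.yield {c : A.Cfg} {d d' : (A.toATM q₀ inp letter).Cfg}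
    (h : A.RepresentsMid q₀ inp letter c d) (hs : (A.toATM q₀ inp letter).Yield d d') :
    A.RepresentsMid q₀ inp letter c d' ∨
      ∃ c', A.Yield c c' ∧ A.Represents q₀ inp letter c' d' := by
  obtain ⟨q, T⟩ := c
  obtain ⟨p, t⟩ := d
  obtain ⟨p', t'⟩ := d'
  obtain ⟨a, hδ, ha⟩ := hs
  simp only at hδ ha
  change A.TapeRule p t.scan a p' at hδ
  change ActStep (false, fun _ => none) a t t' at ha
  rcases h with ⟨hp, hpos, hcells⟩ | ⟨r, ph, hp, hq, h0, hinv⟩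
  · simp only at hp hpos hcells
    subst hp
    cases hδ with
    | choose r γ =>
      refine .inl (.inr ⟨r, .start, rfl, rfl, ?_, ?_, ?_⟩)
      · simp [ha.cell_write, hpos]
      · simp [ha.pos_write, hpos]
      · intro i
        simp only [ha.cell_write, hpos]
        simpa using hcells i
  · simp only at hp hq h0 hinv
    subst hp hq
    cases hδ with
    | start =>
      refine .inl (.inr ⟨r, .seek, rfl, rfl, ?_, ?_, ?_, ?_⟩)
      · simpa [ha.cell_right] using h0
      · simp [ha.pos_right]
      · simp [ha.pos_right, hinv.1]
      · simpa [ha.cell_right] using hinv.2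
    | seekRight _ _ hne =>
      refine .inl (.inr ⟨r, .seek, rfl, rfl, ?_, ?_, ?_, ?_⟩)
      · simpa [ha.cell_right] using h0
      · simp [ha.pos_right]
      · obtain ⟨h1, h2, h3⟩ := hinv
        obtain ⟨i, hi⟩ : ∃ i, t.pos = i + 1 := ⟨t.pos - 1, by omega⟩
        rw [← Tape.cell_pos (blank := (false, fun _ => none)), hi, h3] at hne
        simp only [ne_eq, List.getElem?_eq_none_iff, List.length_reverse, not_le] at hne
        simp only [ha.pos_right]
        omega
      · simpa [ha.cell_right] using hinv.2.2
    | seekPush _ k s _ ho hn =>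
      obtain ⟨h1, h2, h3⟩ := hinv
      simp only [ho, SOp.stack] at h2
      obtain ⟨i, hi⟩ : ∃ i, t.pos = i + 1 := ⟨t.pos - 1, by omega⟩
      rw [← Tape.cell_pos (blank := (false, fun _ => none)), hi, h3] at hn
      simp only [List.getElem?_eq_none_iff, List.length_reverse] at hn
      obtain rfl : i = (T k).length := by omega
      refine .inl (.inr ⟨r, .back, rfl, rfl, ?_,
        Function.update T k (s :: T k), ?_, ?_⟩)
      · simpa [ha.cell_write, hi] using h0
      · simp [ho, SOp.Rel]
      · simp only [ha.cell_write, hi]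
        have := h3.push k s
        rwa [← hi, Tape.cell_pos, hi] at this
    | seekTop _ k o b _ ho hn =>
      obtain ⟨h1, h2, h3⟩ := hinv
      simp only [ho, SOp.stack] at h2
      obtain ⟨i, hi⟩ : ∃ i, t.pos = i + 1 := ⟨t.pos - 1, by omega⟩
      rw [← Tape.cell_pos (blank := (false, fun _ => none)), hi, h3] at hn
      simp only [List.getElem?_eq_none_iff, List.length_reverse] at hn
      refine .inl (.inr ⟨r, .edit, rfl, rfl, ?_, ?_, ?_⟩)
      · simpa [ha.cell_left] using h0
      · simp only [ha.pos_left, ho, SOp.stack]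
        omega
      · simpa [ha.cell_left] using h3
    | edit _ k o b _ ho he =>
      obtain ⟨h1, h2⟩ := hinv
      simp only [ho, SOp.stack] at h1
      have htop := h2.cell_length h0 k
      rw [← h1, Tape.cell_pos, he] at htop
      refine .inl (.inr ⟨r, .back, rfl, rfl, ?_,
        Function.update T k (if b then T k else (T k).tail), ?_, ?_⟩)
      · rw [ha.cell_write, Function.update_apply]
        by_cases h : 0 = t.pos
        · rw [if_pos h]
          rw [← Tape.cell_pos (blank := (false, fun _ => none)), ← h, h0]
          refine Prod.ext rfl ?_
          have : o = none := by
            rw [htop]; rw [← h] at h1; simp [List.eq_nil_of_length_eq_zero h1.symm]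
          simp [this, marker]
        · rwa [if_neg h]
      · simp [ho, SOp.Rel, htop]
      · simp only [ha.cell_write]
        have := h2.top k b
        rwa [← h1, Tape.cell_pos, ← htop] at this
    | backLeft =>
      obtain ⟨T', h1, h2⟩ := hinv
      refine .inl (.inr ⟨r, .back, rfl, rfl, ?_, T', h1, ?_⟩)
      · simpa [ha.cell_left] using h0
      · simpa [ha.cell_left] using h2
    | backDone _ _ hm =>
      obtain ⟨T', h1, h2⟩ := hinv
      refine .inr ⟨(r.1.2.2, T'), ⟨r.1.2.1, r.2, h1⟩, rfl, ?_, ?_⟩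
      · rw [← Tape.cell_pos (blank := (false, fun _ => none))] at hm
        simp only [ha.pos_write]
        by_contra hne
        obtain ⟨i, hi⟩ := Nat.exists_eq_succ_of_ne_zero hne
        rw [hi, Nat.succ_eq_add_one, h2] at hm
        simp at hm
      · simp only [ha.cell_write]
        rw [← Tape.cell_pos (blank := (false, fun _ => none)), Function.update_eq_self]
        exact h2

theorem exists_yield {p p' : A.Q ⊕ (A.Rule × Phase)} {t : Tape (Cell K S)}
    {a : Act (Cell K S)} (hδ : A.TapeRule p t.scan a p') :
    ∃ t', ActStep (false, fun _ => none) a t t' ∧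
      (A.toATM q₀ inp letter).Yield (p, t) (p', t') := by
  obtain ⟨t', ht⟩ := ActStep.exists (blank := (false, fun _ => none)) a t
  exact ⟨t', ht, a, hδ, ht⟩

theorem tChain_seek (r : A.Rule) (T : K → List S) (n : ℕ) (t : Tape (Cell K S))
    (hn : t.pos + n = (T r.1.2.1.stack).length + 1) (hpos : 1 ≤ t.pos)
    (hcells : StackCells T (t.cell (false, fun _ => none))) :
    ∃ t', TChain (A.toATM q₀ inp letter).cfgE (A.toATM q₀ inp letter).Yield (A.isE r.1.1)
        (.inr (r, .seek), t) (.inr (r, .seek), t') ∧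
      t'.pos = (T r.1.2.1.stack).length + 1 ∧
      t'.cell (false, fun _ => none) = t.cell (false, fun _ => none) := by
  induction n generalizing t with
  | zero => exact ⟨t, .refl, hn, rfl⟩
  | succ n ih =>
    have hγ : t.scan.2 r.1.2.1.stack ≠ none := by
      obtain ⟨i, hi⟩ : ∃ i, t.pos = i + 1 := ⟨t.pos - 1, by omega⟩
      rw [← Tape.cell_pos (blank := (false, fun _ => none)), hi, hcells]
      simp only [ne_eq, List.getElem?_eq_none_iff, List.length_reverse, not_le]
      omega
    obtain ⟨t1, h1, hy⟩ := exists_yield (q₀ := q₀) (inp := inp) (letter := letter)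
      (TapeRule.seekRight r _ hγ)
    obtain ⟨t', hc, hp, hcell⟩ := ih t1 (by rw [h1.pos_right]; omega) (by rw [h1.pos_right]; omega)
      (by rwa [h1.cell_right])
    exact ⟨t', .head ⟨rfl, hy⟩ hc, hp, hcell.trans h1.cell_right⟩

theorem tChain_back (r : A.Rule) (T : K → List S) (n : ℕ) (t : Tape (Cell K S)) (hn : t.pos = n)
    (h0 : t.cell (false, fun _ => none) 0 = marker)
    (hcells : StackCells T (t.cell (false, fun _ => none))) :
    ∃ t', TChain (A.toATM q₀ inp letter).cfgE (A.toATM q₀ inp letter).Yield (A.isE r.1.1)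
        (.inr (r, .back), t) (.inl r.1.2.2, t') ∧
      t'.pos = 0 ∧ StackCells T (t'.cell (false, fun _ => none)) := by
  induction n generalizing t with
  | zero =>
    have hγ : t.scan.1 = true := by
      rw [← Tape.cell_pos (blank := (false, fun _ => none)), hn, h0]; rfl
    obtain ⟨t1, h1, hy⟩ := exists_yield (q₀ := q₀) (inp := inp) (letter := letter)
      (TapeRule.backDone r _ hγ)
    refine ⟨t1, .single ⟨rfl, hy⟩, by rw [h1.pos_write, hn], ?_⟩
    rw [h1.cell_write, ← Tape.cell_pos (blank := (false, fun _ => none)), Function.update_eq_self]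
    exact hcells
  | succ n ih =>
    have hγ : t.scan.1 = false := by
      rw [← Tape.cell_pos (blank := (false, fun _ => none)), hn, hcells]
    obtain ⟨t1, h1, hy⟩ := exists_yield (q₀ := q₀) (inp := inp) (letter := letter)
      (TapeRule.backLeft r _ hγ)
    obtain ⟨t', hc, hp, hcell⟩ := ih t1 (by rw [h1.pos_left]; omega) (by rwa [h1.cell_left])
      (by rwa [h1.cell_left])
    exact ⟨t', .head ⟨rfl, hy⟩ hc, hp, hcell⟩

theorem Represents.yield {c c' : A.Cfg} {d : (A.toATM q₀ inp letter).Cfg} (hs : A.Yield c c')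
    (h : A.Represents q₀ inp letter c d) :
    ∃ d', TChain (A.toATM q₀ inp letter).cfgE (A.toATM q₀ inp letter).Yield (A.cfgE c) d d' ∧
      A.Represents q₀ inp letter c' d' := by
  obtain ⟨q, T⟩ := c
  obtain ⟨q', T'⟩ := c'
  obtain ⟨p, t⟩ := d
  obtain ⟨o, hδ, ho⟩ := hs
  obtain ⟨hp, hpos, hcells⟩ := h
  simp only at hδ ho hp hpos hcells
  subst hp
  let r : A.Rule := ⟨(q, o, q'), hδ⟩
  obtain ⟨t1, h1, hy1⟩ := exists_yield (q₀ := q₀) (inp := inp) (letter := letter)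
    (TapeRule.choose r t.scan)
  obtain ⟨t2, h2, hy2⟩ := exists_yield (q₀ := q₀) (inp := inp) (letter := letter)
    (TapeRule.start r t1.scan)
  have hpos2 : t2.pos = 1 := by rw [h2.pos_right, h1.pos_write, hpos]
  have h02 : t2.cell (false, fun _ => none) 0 = marker := by
    rw [h2.cell_right, h1.cell_write, hpos, Function.update_self]
  have hcells2 : StackCells T (t2.cell (false, fun _ => none)) := by
    intro i
    rw [h2.cell_right, h1.cell_write, hpos, Function.update_of_ne (by omega)]
    exact hcells i
  obtain ⟨t3, hc3, hpos3, hcell3⟩ := tChain_seek (q₀ := q₀) (inp := inp) (letter := letter) r T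
    (T o.stack).length t2 (by rw [hpos2, add_comm]) hpos2.ge hcells2
  simp only [r] at hpos3
  rw [← hcell3] at h02 hcells2
  obtain ⟨t4, hc4, h04, hcells4⟩ : ∃ t4,
      TChain (A.toATM q₀ inp letter).cfgE (A.toATM q₀ inp letter).Yield (A.isE q)
        (.inr (r, .seek), t3) (.inr (r, .back), t4) ∧
      t4.cell (false, fun _ => none) 0 = marker ∧
      StackCells T' (t4.cell (false, fun _ => none)) := by
    cases o with
    | push k s =>
      simp only [SOp.stack] at hpos3
      have hγ : t3.scan.2 k = none := by
        rw [← Tape.cell_pos (blank := (false, fun _ => none)), hpos3, hcells2]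
        simp
      obtain ⟨t4, h4, hy4⟩ := exists_yield (q₀ := q₀) (inp := inp) (letter := letter)
        (TapeRule.seekPush r k s t3.scan rfl hγ)
      refine ⟨t4, .single ⟨rfl, hy4⟩, ?_, ?_⟩
      · rw [h4.cell_write, hpos3, Function.update_of_ne (by omega), h02]
      · have := hcells2.push k s
        rw [← hpos3, Tape.cell_pos] at this
        rw [h4.cell_write, ho]
        exact this
    | top k o b =>
      simp only [SOp.stack] at hpos3
      obtain ⟨ho1, ho2⟩ := ho
      have hγ : t3.scan.2 k = none := by
        rw [← Tape.cell_pos (blank := (false, fun _ => none)), hpos3, hcells2]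
        simp
      obtain ⟨t5, h5, hy5⟩ := exists_yield (q₀ := q₀) (inp := inp) (letter := letter)
        (TapeRule.seekTop r k o b t3.scan rfl hγ)
      have hpos5 : t5.pos = (T k).length := by rw [h5.pos_left, hpos3, Nat.add_sub_cancel]
      rw [← h5.cell_left] at h02 hcells2
      have htop := hcells2.cell_length h02 k
      rw [← hpos5, Tape.cell_pos] at htop
      obtain ⟨t4, h4, hy4⟩ := exists_yield (q₀ := q₀) (inp := inp) (letter := letter)
        (TapeRule.edit r k o b t5.scan rfl (htop.trans ho1))
      refine ⟨t4, .head ⟨rfl, hy5⟩ (.single ⟨rfl, hy4⟩), ?_, ?_⟩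
      · rw [h4.cell_write, Function.update_apply]
        by_cases h : 0 = t5.pos
        · rw [if_pos h]
          rw [← h] at hpos5
          have : o = none := by
            rw [← ho1, List.eq_nil_of_length_eq_zero hpos5.symm, List.head?_nil]
          rw [← Tape.cell_pos (blank := (false, fun _ => none)), ← h, h02]
          simp [this, marker]
        · rwa [if_neg h]
      · have := hcells2.top k b
        rw [← hpos5, Tape.cell_pos, ho1] at this
        rw [h4.cell_write, ho2]
        exact this
  obtain ⟨t6, hc6, hpos6, hcells6⟩ := tChain_back (q₀ := q₀) (inp := inp) (letter := letter) r T'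
    _ t4 rfl h04 hcells4
  exact ⟨_, .head ⟨rfl, hy1⟩ (.head ⟨rfl, hy2⟩ (hc3.trans (hc4.trans hc6))), rfl, hpos6, hcells6⟩

theorem Represents.accepted_iff {c : A.Cfg} {d : (A.toATM q₀ inp letter).Cfg}
    (h : A.Represents q₀ inp letter c d) :
    Accepted A.cfgE A.Yield c ↔ (A.toATM q₀ inp letter).Accepted d :=
  accepted_iff_of_simulation (eD := (A.toATM q₀ inp letter).cfgE)
    (sD := (A.toATM q₀ inp letter).Yield) (fun _ _ => .inl) (fun _ _ => RepresentsMid.cfgE)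
    (fun _ _ _ => Represents.yield) (fun _ _ _ => RepresentsMid.yield) h

theorem represents_init (w : List α) :
    A.Represents q₀ inp letter
      (q₀, Function.update (fun _ => []) inp (w.map letter).reverse)
      ((A.toATM q₀ inp letter).init w) := by
  refine ⟨rfl, rfl, fun i => ?_⟩
  have h : Tape.cell (false, fun _ => none) ((A.toATM q₀ inp letter).init w).2 (i + 1) =
      (w[i]?.map fun a => letterCell inp (letter a)).getD (false, fun _ => none) := by
    rw [← List.getElem?_map, ← List.getD_eq_getElem?_getD]
    rfl
  rw [h]
  refine Prod.ext ?_ (funext fun k => ?_)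
  · cases w[i]? <;> rfl
  · rcases eq_or_ne k inp with rfl | hk
    · cases h : w[i]? <;> simp [h, letterCell_snd_self]
    · cases w[i]? <;> simp [hk, letterCell_snd_of_ne]

/-- A potential on the states bounds the number of alternations of the simulating machine. -/
theorem altBound_toATM (rank : A.Q → ℕ)
    (hrank : ∀ q o q', A.δ q o q' → rank q' + (if A.isE q ≠ A.isE q' then 1 else 0) ≤ rank q) :
    (A.toATM q₀ inp letter).AltBound (rank q₀) := by
  intro w n d hd0 hd
  have := card_alternations_le (isE := (A.toATM q₀ inp letter).cfgE)
    (fun c => Sum.elim rank (fun x => rank x.1.1.1) c.1) ?_ n d hd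
  · rw [hd0] at this
    exact this
  · rintro ⟨p, t⟩ ⟨p', t'⟩ ⟨a, hδ, -⟩
    change A.TapeRule p t.scan a p' at hδ
    simp only [ATM.cfgE, toATM]
    cases hδ with
    | backDone r γ h => exact hrank _ _ _ r.2
    | _ => simp

theorem toATM_δ_isE {b : Bool} (h : ∀ q o q', A.δ q o q' → A.isE q = b)
    {p p' : (A.toATM q₀ inp letter).Q} {γ : Cell K S} {a : Act (Cell K S)}
    (hδ : (A.toATM q₀ inp letter).δ p γ a p') : (A.toATM q₀ inp letter).isE p = b := by
  change A.TapeRule p γ a p' at hδ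
  cases hδ with
  | choose r γ => exact h _ _ _ r.2
  | start r => exact h _ _ _ r.2
  | seekRight r => exact h _ _ _ r.2
  | seekPush r => exact h _ _ _ r.2
  | seekTop r => exact h _ _ _ r.2
  | edit r => exact h _ _ _ r.2
  | backLeft r => exact h _ _ _ r.2
  | backDone r => exact h _ _ _ r.2

end Simulation

end ASM
end ATMPaper

namespace ATMPaper
open Turing ToPartrec

theorem code_comp_eval {f g : Code} {v w : List ℕ} (h : g.eval v = Part.some w) :
    (f.comp g).eval v = f.eval w := by
  change (g.eval v).bind (fun x => f.eval x) = _
  rw [h, Part.bind_some]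

theorem code_cons_eval {f fs : Code} {v n ns : List ℕ} (h : f.eval v = Part.some n)
    (hs : fs.eval v = Part.some ns) : (f.cons fs).eval v = Part.some (n.headI :: ns) := by
  simp [h, hs]

/-- The code of a list is computed from the codes of its head and tail. -/
theorem exists_code_cons : ∃ c : Code, ∀ acc a : ℕ, c.eval [acc, a] =
    Part.some [if a = 0 then acc else Nat.succ (Nat.pair (a - 1) acc)] := by
  have h : Primrec fun v : List.Vector ℕ 2 =>
      if v.get 1 = 0 then v.get 0 else Nat.succ (Nat.pair (v.get 1 - 1) (v.get 0)) := by
    have h0 : Primrec fun v : List.Vector ℕ 2 => v.get 0 :=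
      Primrec.vector_get.comp .id (.const 0)
    have h1 : Primrec fun v : List.Vector ℕ 2 => v.get 1 :=
      Primrec.vector_get.comp .id (.const 1)
    exact Primrec.ite (Primrec.eq.comp h1 (.const 0)) h0
      (Primrec.succ.comp (Primrec₂.natPair.comp (Primrec.pred.comp h1) h0))
  obtain ⟨c, hc⟩ := Code.exists_code (Nat.Partrec'.prim (Nat.Primrec'.prim_iff.2 h))
  refine ⟨c, fun acc a => (hc ⟨[acc, a], rfl⟩).trans ?_⟩
  simp [List.Vector.get]
  rfl

/-- The code of the reversal of a list is computed from the codes of its entries. -/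
theorem exists_code_list {β : Type*} [Primcodable β] : ∃ c : Code, ∀ s : List β,
    c.eval (s.map fun a => Encodable.encode a + 1) = Part.some [Encodable.encode s.reverse] := by
  obtain ⟨c, hc⟩ := exists_code_cons
  let f : Code := .cons (.comp .head .tail)
    (.cons (.comp c (.cons .head (.cons (.comp .head .tail) .nil))) (.comp .tail .tail))
  have htail (v : List ℕ) : Code.tail.eval v = Part.some v.tail := by simp
  have hzero (v : List ℕ) : Code.zero'.eval v = Part.some (0 :: v) := by simp
  have hht (v : List ℕ) : (Code.comp .head .tail).eval v = Part.some [v.tail.headI] := by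
    rw [code_comp_eval (htail v), Code.head_eval]; rfl
  have hf (v : List ℕ) : f.eval v = Part.some (v.tail.headI ::
      (if v.tail.headI = 0 then v.headI else Nat.succ (Nat.pair (v.tail.headI - 1) v.headI)) ::
        v.tail.tail) := by
    have h1 : (Code.cons .head (.cons (.comp .head .tail) .nil)).eval v =
        Part.some [v.headI, v.tail.headI] :=
      code_cons_eval (n := [v.headI]) (Code.head_eval v)
        (code_cons_eval (n := [v.tail.headI]) (hht v) (Code.nil_eval v))
    exact code_cons_eval (n := [v.tail.headI]) (hht v)
      (code_cons_eval (n := [_]) ((code_comp_eval h1).trans (hc _ _))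
        ((code_comp_eval (htail v)).trans (htail _)))
  have key (s : List β) (t : List β) :
      [Encodable.encode (s.reverse ++ t)] ∈ (Code.fix f).eval
        (Encodable.encode t :: s.map fun a => Encodable.encode a + 1) := by
    induction s generalizing t with
    | nil =>
      refine PFun.mem_fix_iff.2 (.inl ?_)
      rw [hf]
      simp
    | cons a s ih =>
      refine PFun.mem_fix_iff.2 (.inr ⟨_, ?_, by simpa using ih (a :: t)⟩)
      rw [hf]
      simp
  refine ⟨.comp (.fix f) .zero', fun s => ?_⟩
  rw [code_comp_eval (hzero _), Part.eq_some_iff]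
  simpa using key s []

theorem exists_code_of_rePred {β : Type*} [Primcodable β] {H : List β → Prop} (hH : REPred H) :
    ∃ c : Code, ∀ s : List β, (c.eval (s.map fun a => Encodable.encode a + 1)).Dom ↔ H s := by
  obtain ⟨c, hc⟩ := exists_code_list (β := β)
  have h : Partrec fun n : ℕ => (Part.ofOption (Encodable.decode (α := List β) n)).bind
      fun l => (Part.assert (H l.reverse) fun _ => Part.some ()).map fun _ => 0 := by
    refine Partrec.bind (Computable.decode.ofOption) ?_
    exact ((Partrec.comp hH (Primrec.list_reverse.to_comp)).map
      (Computable.const 0).to₂).comp Computable.snd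
  obtain ⟨c', hc'⟩ := Code.exists_code (Nat.Partrec'.part_iff₁.2 h)
  refine ⟨.comp c' c, fun s => ?_⟩
  rw [code_comp_eval (hc s)]
  refine (iff_of_eq (congrArg Part.Dom (hc' ⟨[Encodable.encode s.reverse], rfl⟩))).trans ?_
  simp [List.Vector.head, Part.assert]

end ATMPaper

namespace ATMPaper
open Turing

section Restrict

variable {K S : Type} [DecidableEq K]

namespace ASM

/-- The restriction of a stack machine to a set of states. -/
def restrict (A : ASM K S) (F : Set A.Q) : ASM K S where
  Q := F
  isE q := A.isE q
  δ q o q' := A.δ q o q'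

theorem accepted_restrict (A : ASM K S) {F : Set A.Q} (hF : ∀ q o q', A.δ q o q' → q ∈ F → q' ∈ F)
    (q : F) (T : K → List S) :
    Accepted (A.restrict F).cfgE (A.restrict F).Yield (q, T) ↔
      Accepted A.cfgE A.Yield (q.1, T) := by
  symm
  let B : A.Cfg → (A.restrict F).Cfg → Prop := fun c d => c = (d.1.1, d.2)
  refine accepted_iff_of_simulation (B := B) (M := B) (fun _ _ h => h) ?_ ?_ ?_ rfl
  · rintro c d rfl
    rfl
  · rintro c c' d ⟨o, h1, h2⟩ rfl
    exact ⟨(⟨c'.1, hF _ _ _ h1 d.1.2⟩, c'.2), .single ⟨rfl, o, h1, h2⟩, rfl⟩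
  · rintro c d d' rfl ⟨o, h1, h2⟩
    exact .inr ⟨(d'.1.1, d'.2), ⟨o, h1, h2⟩, rfl⟩

end ASM

end Restrict

/-- The states of a machine that first guesses letters in several phases, then feeds them to a
multi-stack machine, and runs it. -/
inductive GState (K₀ G Λ σ : Type) : Type
  | guess (m : ℕ)
  | load (l : List G)
  | run (q : TM2.Stmt (fun _ : K₀ => G) Λ σ) (v : σ)
  | fin

/-- The data of a machine that guesses letters and runs a multi-stack machine on them. -/
structure Guesser (α Sy K₀ G Λ σ : Type) where
  /-- The type of the final phase. -/
  b : Bool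
  /-- The letters guessed in each phase. -/
  letter : ℕ → α → Sy
  /-- The strings of stack letters coding the letters. -/
  enc : Sy → List G
  /-- The program of the multi-stack machine. -/
  prog : Λ → TM2.Stmt (fun _ : K₀ => G) Λ σ
  /-- The stack holding its input. -/
  main : K₀
  l₀ : Λ
  v₀ : σ

namespace Guesser

variable {α Sy K₀ G Λ σ : Type} (D : Guesser α Sy K₀ G Λ σ)

/-- The transition rules. -/
inductive Rule : GState K₀ G Λ σ → SOp (Option K₀) (Sy ⊕ G) → GState K₀ G Λ σ → Prop
  | guess (m : ℕ) (a : α) : Rule (.guess m) (.push none (.inl (D.letter m a))) (.guess m)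
  | next (m : ℕ) (o : Option (Sy ⊕ G)) : Rule (.guess (m + 1)) (.top none o true) (.guess m)
  | done (o : Option (Sy ⊕ G)) : Rule (.guess 0) (.top none o true) (.load [])
  | loadLetter (x : Sy) :
      Rule (.load []) (.top none (some (.inl x)) false) (.load (D.enc x).reverse)
  | loadPush (g : G) (l : List G) : Rule (.load (g :: l)) (.push (some D.main) (.inr g)) (.load l)
  | loadDone : Rule (.load []) (.top none none true) (.run (D.prog D.l₀) D.v₀)
  | push (k : K₀) (f : σ → G) (q) (v : σ) :
      Rule (.run (.push k f q) v) (.push (some k) (.inr (f v))) (.run q v)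
  | peek (k : K₀) (f : σ → Option G → σ) (q) (v : σ) (o : Option G) :
      Rule (.run (.peek k f q) v) (.top (some k) (o.map .inr) true) (.run q (f v o))
  | pop (k : K₀) (f : σ → Option G → σ) (q) (v : σ) (o : Option G) :
      Rule (.run (.pop k f q) v) (.top (some k) (o.map .inr) false) (.run q (f v o))
  | assign (f : σ → σ) (q) (v : σ) (o : Option (Sy ⊕ G)) :
      Rule (.run (.load f q) v) (.top none o true) (.run q (f v))
  | branch (f : σ → Bool) (q₁ q₂) (v : σ) (o : Option (Sy ⊕ G)) :
      Rule (.run (.branch f q₁ q₂) v) (.top none o true) (.run (cond (f v) q₁ q₂) v)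
  | goto (f : σ → Λ) (v : σ) (o : Option (Sy ⊕ G)) :
      Rule (.run (.goto f) v) (.top none o true) (.run (D.prog (f v)) v)
  | halt (v : σ) (o : Option (Sy ⊕ G)) : Rule (.run .halt v) (.top none o true) .fin

/-- The type of phase `m`; the types alternate. -/
def phaseType : ℕ → Bool
  | 0 => D.b
  | m + 1 => !(phaseType m)

/-- The types of the states. -/
def isE : GState K₀ G Λ σ → Bool
  | .guess m => D.phaseType m
  | .load _ => D.b
  | .run _ _ => D.b
  | .fin => !D.b

/-- The machine as an alternating stack machine. -/
@[reducible]
def toASM : ASM (Option K₀) (Sy ⊕ G) := ⟨GState K₀ G Λ σ, D.isE, D.Rule⟩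

/-- A rank of the states that drops with each alternation. -/
def rank : GState K₀ G Λ σ → ℕ
  | .guess m => m + 1
  | .load _ => 1
  | .run _ _ => 1
  | .fin => 0

theorem rank_le {q q' : GState K₀ G Λ σ} {o : SOp (Option K₀) (Sy ⊕ G)} (h : D.Rule q o q') :
    rank q' + (if D.isE q ≠ D.isE q' then 1 else 0) ≤ rank q := by
  cases h <;> simp [rank, isE, phaseType]

/-- A family of stacks: one of input letters, the others of letters of the inner machine. -/
def stk (t : List Sy) (S : K₀ → List G) : Option K₀ → List (Sy ⊕ G)
  | none => t.map .inl
  | some k => (S k).map .inr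

variable [DecidableEq K₀]

theorem update_stk_none (t t' : List Sy) (S : K₀ → List G) :
    Function.update (stk t S) none (t'.map .inl) = stk t' S := by
  funext k
  cases k <;> simp [stk]

theorem update_stk_some (t : List Sy) (S : K₀ → List G) (k : K₀) (l : List G) :
    Function.update (stk t S) (some k) (l.map .inr) = stk t (Function.update S k l) := by
  funext k'
  cases k' with
  | none => simp [stk]
  | some k' =>
    rcases eq_or_ne k' k with rfl | h
    · simp [stk]
    · simp [stk, h]

theorem push_some_iff {t : List Sy} {S : K₀ → List G} {k : K₀} {g : G}
    {T : Option K₀ → List (Sy ⊕ G)} :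
    (SOp.push (some k) (.inr g)).Rel (stk t S) T ↔ T = stk t (Function.update S k (g :: S k)) := by
  rw [← update_stk_some]; rfl

theorem push_none_iff {t : List Sy} {S : K₀ → List G} {x : Sy}
    {T : Option K₀ → List (Sy ⊕ G)} :
    (SOp.push none (.inl x)).Rel (stk t S) T ↔ T = stk (x :: t) S := by
  rw [← update_stk_none t (x :: t) S]; rfl

theorem nop_iff {T T' : Option K₀ → List (Sy ⊕ G)} {k : Option K₀} {o : Option (Sy ⊕ G)} :
    (SOp.top k o true).Rel T T' ↔ (T k).head? = o ∧ T' = T := by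
  simp [SOp.Rel]

theorem pop_some_iff {t : List Sy} {S : K₀ → List G} {k : K₀} {o : Option G}
    {T : Option K₀ → List (Sy ⊕ G)} :
    (SOp.top (some k) (o.map .inr) false).Rel (stk t S) T ↔
      (S k).head? = o ∧ T = stk t (Function.update S k (S k).tail) := by
  have h : ((S k).map (Sum.inr : G → Sy ⊕ G)).head? = o.map .inr ↔ (S k).head? = o := by
    rw [List.head?_map]
    exact (Option.map_injective Sum.inr_injective).eq_iff
  rw [← update_stk_some, ← h, List.map_tail]
  rfl

theorem peek_some_iff {t : List Sy} {S : K₀ → List G} {k : K₀} {o : Option G}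
    {T : Option K₀ → List (Sy ⊕ G)} :
    (SOp.top (some k) (o.map .inr) true).Rel (stk t S) T ↔ (S k).head? = o ∧ T = stk t S := by
  have h : ((S k).map (Sum.inr : G → Sy ⊕ G)).head? = o.map .inr ↔ (S k).head? = o := by
    rw [List.head?_map]
    exact (Option.map_injective Sum.inr_injective).eq_iff
  rw [nop_iff, ← h]
  rfl

theorem pop_letter_iff {t : List Sy} {S : K₀ → List G} {x : Sy}
    {T : Option K₀ → List (Sy ⊕ G)} :
    (SOp.top none (some (.inl x)) false).Rel (stk t S) T ↔
      ∃ t', t = x :: t' ∧ T = stk t' S := by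
  cases t with
  | nil => simp [SOp.Rel, stk]
  | cons y t =>
    rw [SOp.Rel]
    have := update_stk_none (y :: t) t S
    simp [stk] at this ⊢
    grind

/-- A configuration of the inner machine as a configuration of the outer one. -/
def conf (t : List Sy) (c : TM2.Cfg (fun _ : K₀ => G) Λ σ) : D.toASM.Cfg :=
  (c.l.elim .fin fun l => .run (D.prog l) c.var, stk t c.stk)

/-- One step of the computation. -/
def Next (c c' : D.toASM.Cfg) : Prop := D.toASM.cfgE c = D.b ∧ D.toASM.Yield c c'

theorem next_of_rule {q q' : GState K₀ G Λ σ} {o : SOp (Option K₀) (Sy ⊕ G)}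
    {T T' : Option K₀ → List (Sy ⊕ G)} (hq : D.isE q = D.b) (h : D.Rule q o q') (ho : o.Rel T T') :
    D.Next (q, T) (q', T') :=
  ⟨hq, o, h, ho⟩

theorem reach_stepAux (t : List Sy) (q : TM2.Stmt (fun _ : K₀ => G) Λ σ) (v : σ)
    (S : K₀ → List G) :
    Relation.ReflTransGen D.Next (.run q v, stk t S) (D.conf t (TM2.stepAux q v S)) := by
  induction q generalizing v S with
  | push k f q ih =>
    exact .head (D.next_of_rule rfl (.push k f q v) (push_some_iff.2 rfl)) (ih _ _)
  | peek k f q ih =>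
    exact .head (D.next_of_rule rfl (.peek k f q v _) (peek_some_iff.2 ⟨rfl, rfl⟩)) (ih _ _)
  | pop k f q ih =>
    exact .head (D.next_of_rule rfl (.pop k f q v _) (pop_some_iff.2 ⟨rfl, rfl⟩)) (ih _ _)
  | load f q ih =>
    exact .head (D.next_of_rule rfl (.assign f q v _) (nop_iff.2 ⟨rfl, rfl⟩)) (ih _ _)
  | branch f q₁ q₂ ih₁ ih₂ =>
    refine .head (D.next_of_rule rfl (.branch f q₁ q₂ v _) (nop_iff.2 ⟨rfl, rfl⟩)) ?_
    rw [TM2.stepAux]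
    cases f v
    · exact ih₂ _ _
    · exact ih₁ _ _
  | goto f => exact .single (D.next_of_rule rfl (.goto f v _) (nop_iff.2 ⟨rfl, rfl⟩))
  | halt => exact .single (D.next_of_rule rfl (.halt v _) (nop_iff.2 ⟨rfl, rfl⟩))

theorem reach_of_reaches (t : List Sy) {c c' : TM2.Cfg (fun _ : K₀ => G) Λ σ}
    (h : StateTransition.Reaches (TM2.step D.prog) c c') :
    Relation.ReflTransGen D.Next (D.conf t c) (D.conf t c') := by
  induction h with
  | refl => exact .refl
  | @tail c₁ c₂ _ hs ih =>
    refine ih.trans ?_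
    obtain ⟨_ | l, v, S⟩ := c₁
    · simp at hs
    · simp only [TM2.step, Option.mem_def, Option.some.injEq] at hs
      subst hs
      exact D.reach_stepAux t (D.prog l) v S

/-- The main stack after feeding it the letters of `t`. -/
def fed (t : List Sy) (M : List G) : List G := t.foldl (fun M x => D.enc x ++ M) M

/-- The inner machine halts, started at label `l₀` with main stack `M`. -/
def HaltsOn (M : List G) : Prop :=
  (StateTransition.eval (TM2.step D.prog)
    ⟨some D.l₀, D.v₀, Function.update (fun _ => []) D.main M⟩).Dom

theorem reach_load (l : List G) (t : List Sy) (M : List G) :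
    Relation.ReflTransGen D.Next (.load l, stk t (Function.update (fun _ => []) D.main M))
      (.load [], stk t (Function.update (fun _ => []) D.main (l.reverse ++ M))) := by
  induction l generalizing M with
  | nil => exact .refl
  | cons g l ih =>
    refine .head (D.next_of_rule rfl (.loadPush g l) (push_some_iff.2 rfl)) ?_
    simpa using ih (g :: M)

theorem reach_run (t : List Sy) (M : List G) :
    Relation.ReflTransGen D.Next (.load [], stk t (Function.update (fun _ => []) D.main M))
      (.run (D.prog D.l₀) D.v₀, stk [] (Function.update (fun _ => []) D.main (D.fed t M))) := by
  induction t generalizing M with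
  | nil => exact .single (D.next_of_rule rfl .loadDone (nop_iff.2 ⟨rfl, rfl⟩))
  | cons x t ih =>
    refine .head (D.next_of_rule rfl (.loadLetter x) (pop_letter_iff.2 ⟨_, rfl, rfl⟩)) ?_
    refine (D.reach_load _ t M).trans ?_
    rw [List.reverse_reverse]
    exact ih _

/-- A property of the configurations in the final phase from which the machine can reach its
last state. -/
def Halting : D.toASM.Cfg → Prop
  | (.guess _, _) => True
  | (.load l, T) => ∀ t M, T = stk t (Function.update (fun _ => []) D.main M) →
      D.HaltsOn (D.fed t (l.reverse ++ M))
  | (.run q v, T) => ∀ t S, T = stk t S →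
      (StateTransition.eval (TM2.step D.prog) (TM2.stepAux q v S)).Dom
  | (.fin, _) => True

theorem Halting.of_next {c c' : D.toASM.Cfg} (h : D.Next c c') (hc' : D.Halting c') :
    D.Halting c := by
  obtain ⟨q, T⟩ := c
  obtain ⟨q', T'⟩ := c'
  obtain ⟨-, o, hr, ho⟩ := h
  cases hr with
  | guess | next | done => trivial
  | loadLetter x =>
    rintro t M rfl
    obtain ⟨t', rfl, rfl⟩ := pop_letter_iff.1 ho
    simpa [fed] using hc' t' M rfl
  | loadPush g l =>
    rintro t M rfl
    have := hc' t (g :: M) (by simpa using push_some_iff.1 ho)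
    simpa using this
  | loadDone =>
    rintro t M rfl
    obtain ⟨h1, rfl⟩ := nop_iff.1 ho
    cases t with
    | cons x t => simp [stk] at h1
    | nil =>
      have := hc' [] _ rfl
      rw [HaltsOn, StateTransition.reaches_eval (Relation.ReflTransGen.single (TM2.step.eq_2 ..))]
      exact this
  | push k f q v =>
    rintro t S rfl
    exact hc' t _ (push_some_iff.1 ho)
  | peek k f q v o =>
    rintro t S rfl
    obtain ⟨rfl, h⟩ := peek_some_iff.1 ho
    exact hc' t _ h
  | pop k f q v o =>
    rintro t S rfl
    obtain ⟨rfl, h⟩ := pop_some_iff.1 ho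
    exact hc' t _ h
  | assign f q v o =>
    rintro t S rfl
    exact hc' t _ (nop_iff.1 ho).2
  | branch f q₁ q₂ v o =>
    rintro t S rfl
    have := hc' t _ (nop_iff.1 ho).2
    rw [TM2.stepAux]
    cases h : f v <;> simpa [h] using this
  | goto f v o =>
    rintro t S rfl
    have := hc' t _ (nop_iff.1 ho).2
    rw [TM2.stepAux, StateTransition.reaches_eval
      (Relation.ReflTransGen.single (TM2.step.eq_2 ..))]
    exact this
  | halt v o =>
    rintro t S rfl
    rw [TM2.stepAux]
    exact Part.dom_iff_mem.2 ⟨_, StateTransition.mem_eval.2 ⟨.refl, rfl⟩⟩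

theorem reaches_fin_iff (t : List Sy) :
    (∃ T, Relation.ReflTransGen D.Next (.load [], stk t fun _ => []) (.fin, T)) ↔
      D.HaltsOn (D.fed t []) := by
  have h0 : (fun _ : K₀ => ([] : List G)) = Function.update (fun _ => []) D.main [] := by simp
  constructor
  · rintro ⟨T, h⟩
    have key : ∀ c, Relation.ReflTransGen D.Next c (.fin, T) → D.Halting c := by
      intro c hc
      induction hc using Relation.ReflTransGen.head_induction_on with
      | refl => trivial
      | head hs _ ih => exact Halting.of_next D hs ih
    exact key _ h t [] (by rw [← h0])
  · intro h
    obtain ⟨c, hc⟩ := Part.dom_iff_mem.1 h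
    obtain ⟨hr, hn⟩ := StateTransition.mem_eval.1 hc
    have h1 := D.reach_of_reaches [] hr
    have h2 := D.reach_run t []
    rw [← h0] at h2
    obtain ⟨_ | l, v, S⟩ := c
    · exact ⟨_, h2.trans h1⟩
    · simp at hn

end Guesser

section Generic

variable {C : Type*} {isE : C → Bool} {step : C → C → Prop}

theorem TPivot.eq_of_isE {b : Bool} {c c' : C} (h : TPivot isE step b c c') (hc : isE c = !b) :
    c' = c := by
  rcases Relation.ReflTransGen.cases_head h.1 with rfl | ⟨e, he, _⟩
  · rfl
  · simp [hc] at he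

theorem exists_tPivot_and_accepted {c : C} :
    (∃ c', TPivot isE step true c c' ∧ Accepted isE step c') ↔ Accepted isE step c := by
  cases h : isE c with
  | true => rw [← accepted_of_true h]
  | false =>
    constructor
    · rintro ⟨c', hp, ha⟩
      exact hp.eq_of_isE h ▸ ha
    · exact fun ha => ⟨c, ⟨.refl, h⟩, ha⟩

theorem forall_tPivot_imp_accepted {c : C} :
    (∀ c', TPivot isE step false c c' → Accepted isE step c') ↔ Accepted isE step c := by
  cases h : isE c with
  | false => rw [← accepted_of_false h]
  | true =>
    constructor
    · exact fun ha => ha c ⟨.refl, h⟩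
    · exact fun ha c' hp => hp.eq_of_isE h ▸ ha

end Generic

namespace Guesser

variable {α Sy K₀ G Λ σ : Type} (D : Guesser α Sy K₀ G Λ σ)

/-- The state in which `n` phases of guessing remain. -/
def stage : ℕ → GState K₀ G Λ σ
  | 0 => .load []
  | n + 1 => .guess n

theorem rule_stage (m : ℕ) (o : Option (Sy ⊕ G)) :
    D.Rule (.guess m) (.top none o true) (stage m) := by
  cases m
  · exact .done o
  · exact .next _ o

variable [DecidableEq K₀]

theorem accepted_fin (T : Option K₀ → List (Sy ⊕ G)) :
    Accepted D.toASM.cfgE D.toASM.Yield (.fin, T) ↔ D.b = true := by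
  have hp : ∀ c', ¬ TPivot D.toASM.cfgE D.toASM.Yield (!D.b) (.fin, T) c' := by
    rintro c' ⟨h, hc'⟩
    rcases Relation.ReflTransGen.cases_head h with rfl | ⟨e, ⟨-, o, hr, -⟩, -⟩
    · simp [ASM.cfgE, isE] at hc'
    · cases hr
  cases hb : D.b with
  | true =>
    rw [accepted_of_false (by simp [ASM.cfgE, isE, hb])]
    simp only [hb] at hp
    simp only [iff_true]
    exact fun c' hc' => absurd hc' (hp c')
  | false =>
    rw [accepted_of_true (by simp [ASM.cfgE, isE, hb])]
    simp only [hb] at hp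
    simp only [Bool.false_eq_true, iff_false, not_exists, not_and]
    exact fun c' hc' => absurd hc' (hp c')

theorem eq_fin_of_reaches {c c' : D.toASM.Cfg} (h : Relation.ReflTransGen D.Next c c')
    (hc : ∀ m, c.1 ≠ .guess m) (hc' : D.isE c'.1 = !D.b) : c'.1 = .fin := by
  have : ∀ m, c'.1 ≠ .guess m := by
    induction h using Relation.ReflTransGen.head_induction_on with
    | refl => exact hc
    | @head c c₁ hs _ ih =>
      refine ih fun m hm => ?_
      obtain ⟨q, T⟩ := c
      obtain ⟨q₁, T₁⟩ := c₁
      obtain ⟨-, o, hr, -⟩ := hs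
      cases hr <;> simp_all
  obtain ⟨q, T⟩ := c'
  cases q <;> simp_all [isE]

theorem accepted_load (t : List Sy) :
    Accepted D.toASM.cfgE D.toASM.Yield (.load [], stk t fun _ => []) ↔
      (D.HaltsOn (D.fed t []) ↔ D.b = true) := by
  have hp : ∀ c', TPivot D.toASM.cfgE D.toASM.Yield D.b (.load [], stk t fun _ => []) c' ↔
      ∃ T, c' = (.fin, T) ∧
        Relation.ReflTransGen D.Next (.load [], stk t fun _ => []) (.fin, T) := by
    intro c'
    constructor
    · rintro ⟨h, hc'⟩
      have := D.eq_fin_of_reaches h (by simp) hc'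
      obtain ⟨q, T⟩ := c'
      obtain rfl : q = .fin := this
      exact ⟨T, rfl, h⟩
    · rintro ⟨T, rfl, h⟩
      exact ⟨h, rfl⟩
  rw [← D.reaches_fin_iff]
  cases hb : D.b with
  | true =>
    simp only [hb] at hp
    rw [accepted_of_true (by simp [ASM.cfgE, isE, hb])]
    simp only [hp]
    constructor
    · rintro ⟨_, ⟨T, rfl, h⟩, -⟩
      simpa using ⟨T, h⟩
    · intro h
      obtain ⟨T, h⟩ := h.2 trivial
      exact ⟨_, ⟨T, rfl, h⟩, (D.accepted_fin T).2 hb⟩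
  | false =>
    simp only [hb] at hp
    rw [accepted_of_false (by simp [ASM.cfgE, isE, hb])]
    simp only [hp]
    constructor
    · intro h
      simp only [Bool.false_eq_true, iff_false, not_exists]
      intro T hT
      have := (D.accepted_fin T).1 (h _ ⟨T, rfl, hT⟩)
      simp [hb] at this
    · rintro h _ ⟨T, rfl, hT⟩
      simp only [Bool.false_eq_true, iff_false, not_exists] at h
      exact absurd hT (h T)

theorem guess_reach (m : ℕ) (t : List Sy) (x : List α) :
    TChain D.toASM.cfgE D.toASM.Yield (D.phaseType m) (.guess m, stk t fun _ => [])
      (.guess m, stk (x.map (D.letter m) ++ t) fun _ => []) := by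
  induction x with
  | nil => exact .refl
  | cons a x ih => exact ih.tail ⟨rfl, _, .guess m a, push_none_iff.2 rfl⟩

theorem guess_chain {m : ℕ} {t : List Sy} {b : Bool} {c : D.toASM.Cfg}
    (h : TChain D.toASM.cfgE D.toASM.Yield b (.guess m, stk t fun _ => []) c) :
    ∃ x : List α, c = (.guess m, stk (x.map (D.letter m) ++ t) fun _ => []) ∨
      TChain D.toASM.cfgE D.toASM.Yield b
        (stage m, stk (x.map (D.letter m) ++ t) fun _ => []) c := by
  induction h with
  | refl => exact ⟨[], .inl rfl⟩
  | @tail c c' _ hs ih =>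
    obtain ⟨x, rfl | ih⟩ := ih
    · obtain ⟨q, T⟩ := c'
      obtain ⟨-, o, hr, ho⟩ := hs
      cases hr with
      | guess _ a => exact ⟨a :: x, .inl (Prod.ext rfl (push_none_iff.1 ho))⟩
      | next _ o =>
        refine ⟨x, .inr ?_⟩
        obtain rfl := (nop_iff.1 ho).2
        exact .refl
      | done o =>
        refine ⟨x, .inr ?_⟩
        obtain rfl := (nop_iff.1 ho).2
        exact .refl
    · exact ⟨x, .inr (ih.tail hs)⟩

theorem tPivot_guess {m : ℕ} {t : List Sy} {c : D.toASM.Cfg} :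
    TPivot D.toASM.cfgE D.toASM.Yield (D.phaseType m) (.guess m, stk t fun _ => []) c ↔
      ∃ x : List α, TPivot D.toASM.cfgE D.toASM.Yield (D.phaseType m)
        (stage m, stk (x.map (D.letter m) ++ t) fun _ => []) c := by
  constructor
  · rintro ⟨h, hc⟩
    obtain ⟨x, rfl | h⟩ := D.guess_chain h
    · simp [ASM.cfgE, isE] at hc
    · exact ⟨x, h, hc⟩
  · rintro ⟨x, h, hc⟩
    have hs : D.toASM.Yield (.guess m, stk (x.map (D.letter m) ++ t) fun _ : K₀ => [])
        (stage m, stk (x.map (D.letter m) ++ t) fun _ => []) :=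
      ⟨_, D.rule_stage m _, nop_iff.2 ⟨rfl, rfl⟩⟩
    exact ⟨((D.guess_reach m t x).tail ⟨rfl, hs⟩).trans h, hc⟩

theorem accepted_guess_of_true {m : ℕ} (hm : D.phaseType m = true) (t : List Sy) :
    Accepted D.toASM.cfgE D.toASM.Yield (.guess m, stk t fun _ => []) ↔
      ∃ x : List α, Accepted D.toASM.cfgE D.toASM.Yield
        (stage m, stk (x.map (D.letter m) ++ t) fun _ => []) := by
  rw [accepted_of_true (by exact hm)]
  have := fun c => D.tPivot_guess (m := m) (t := t) (c := c)
  simp only [hm] at this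
  simp only [this, ← exists_tPivot_and_accepted (c := (stage m, _))]
  grind

theorem accepted_guess_of_false {m : ℕ} (hm : D.phaseType m = false) (t : List Sy) :
    Accepted D.toASM.cfgE D.toASM.Yield (.guess m, stk t fun _ => []) ↔
      ∀ x : List α, Accepted D.toASM.cfgE D.toASM.Yield
        (stage m, stk (x.map (D.letter m) ++ t) fun _ => []) := by
  rw [accepted_of_false (by exact hm)]
  have := fun c => D.tPivot_guess (m := m) (t := t) (c := c)
  simp only [hm] at this
  simp only [this, ← forall_tPivot_imp_accepted (c := (stage m, _))]
  grind

/-- The input stack after `n` phases of guessing. -/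
def build : (n : ℕ) → (Fin n → List α) → List Sy → List Sy
  | 0, _, t => t
  | n + 1, v, t => build n (Fin.tail v) ((v 0).map (D.letter n) ++ t)

theorem accepted_stage (n : ℕ) (t : List Sy) :
    Accepted D.toASM.cfgE D.toASM.Yield (stage n, stk t fun _ => []) ↔
      AltQuant α n (D.isE (stage n)) fun v =>
        (D.HaltsOn (D.fed (D.build n v t) []) ↔ D.b = true) := by
  induction n generalizing t with
  | zero => exact D.accepted_load t
  | succ n ih =>
    have hb : ∀ P : (Fin n → List α) → Prop,
        AltQuant α n (D.isE (stage n)) P ↔ AltQuant α n (!D.phaseType n) P := by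
      intro P
      cases n with
      | zero => rfl
      | succ n => simp [stage, isE, phaseType]
    simp only [stage, isE]
    cases h : D.phaseType n with
    | true =>
      rw [D.accepted_guess_of_true h]
      simp only [ih, hb, h]
      rfl
    | false =>
      rw [D.accepted_guess_of_false h]
      simp only [ih, hb, h]
      rfl

end Guesser

end ATMPaper

namespace ATMPaper
open Turing
namespace Guesser

variable {α Sy K₀ G Λ σ : Type} (D : Guesser α Sy K₀ G Λ σ)

/-- The states used when the machine starts with `n` phases of guessing, all letters are coded by
strings of length at most `N`, and the labels of the program lie in `S`. -/
def states (n N : ℕ) (S : Finset Λ) : Set (GState K₀ G Λ σ)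
  | .guess m => m < n
  | .load l => l.length ≤ N
  | .run q _ => some q ∈ TM2.stmts D.prog S
  | .fin => True

theorem finite_states [Finite G] [Finite σ] (n N : ℕ) (S : Finset Λ) :
    (D.states n N S).Finite := by
  have h := (((Set.finite_lt_nat n).image GState.guess).union
    ((List.finite_length_le G N).image (GState.load (K₀ := K₀) (Λ := Λ) (σ := σ)))).union
    ((((TM2.stmts D.prog S).finite_toSet.preimage (Option.some_injective _).injOn).prod
      (Set.finite_univ (α := σ))).image fun x => GState.run x.1 x.2)
  refine (h.union (Set.finite_singleton .fin)).subset ?_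
  rintro (m | l | ⟨q, v⟩ | _) hq
  · exact .inl (.inl (.inl ⟨m, hq, rfl⟩))
  · exact .inl (.inl (.inr ⟨l, hq, rfl⟩))
  · exact .inl (.inr ⟨(q, v), ⟨hq, trivial⟩, rfl⟩)
  · exact .inr rfl

theorem states_closed {n N : ℕ} {S : Finset Λ} (hN : ∀ x, (D.enc x).length ≤ N)
    (hS : @TM2.Supports _ _ _ _ ⟨D.l₀⟩ D.prog S) {q q' : GState K₀ G Λ σ}
    {o : SOp (Option K₀) (Sy ⊕ G)} (h : D.Rule q o q') (hq : q ∈ D.states n N S) :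
    q' ∈ D.states n N S := by
  have hl : ∀ l ∈ S, some (D.prog l) ∈ TM2.stmts D.prog S := fun l hl =>
    Finset.mem_insertNone.2 fun _ ha => Option.some.inj ha ▸
      (by classical exact Finset.mem_biUnion.2 ⟨l, hl, TM2.stmts₁_self⟩)
  cases h with
  | guess => exact hq
  | next => exact (Nat.lt_succ_self _).trans hq
  | done => exact Nat.zero_le _
  | loadLetter x => exact (List.length_reverse).trans_le (hN x)
  | loadPush g l => exact (Nat.le_succ _).trans hq
  | loadDone => exact hl _ hS.1
  | push => exact TM2.stmts_trans (by simp [TM2.stmts₁, TM2.stmts₁_self]) hq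
  | peek => exact TM2.stmts_trans (by simp [TM2.stmts₁, TM2.stmts₁_self]) hq
  | pop => exact TM2.stmts_trans (by simp [TM2.stmts₁, TM2.stmts₁_self]) hq
  | assign => exact TM2.stmts_trans (by simp [TM2.stmts₁, TM2.stmts₁_self]) hq
  | branch f q₁ q₂ v =>
    cases h : f v <;>
      exact TM2.stmts_trans (by simp [TM2.stmts₁, TM2.stmts₁_self]) hq
  | goto f v => exact hl _ (@TM2.stmts_supportsStmt _ _ _ _ ⟨D.l₀⟩ _ _ _ hS hq v)
  | halt => trivial

variable [DecidableEq K₀]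

theorem exists_atm [Finite Sy] [Finite K₀] [Finite G] [Finite σ] (letter : α ↪ Sy)
    (k : ℕ) {S : Finset Λ} (hS : @TM2.Supports _ _ _ _ ⟨D.l₀⟩ D.prog S) :
    ∃ (Γ : Type) (M : ATM α Γ), M.isE M.start = D.phaseType k ∧ M.AltBound (k + 1) ∧
      (k = 0 → ∀ q γ a q', M.δ q γ a q' → M.isE q = D.b) ∧
      ∀ w, M.Accepts w ↔ AltQuant α (k + 1) (D.phaseType k) fun v =>
        (D.HaltsOn (D.fed (D.build (k + 1) v (w.map letter).reverse) []) ↔ D.b = true) := by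
  obtain ⟨N, hN⟩ : ∃ N, ∀ x, (D.enc x).length ≤ N := by
    obtain ⟨N, hN⟩ := (Set.finite_range fun x => (D.enc x).length).bddAbove
    exact ⟨N, fun x => hN ⟨x, rfl⟩⟩
  let F := D.states (k + 1) N S
  let A := D.toASM.restrict F
  have : Finite A.Q := (D.finite_states (k + 1) N S).to_subtype
  let q₀ : A.Q := ⟨.guess k, Nat.lt_succ_self k⟩
  refine ⟨_, A.toATM q₀ none (letter.trans .inl), rfl, ?_, ?_, fun w => ?_⟩
  · exact ASM.altBound_toATM (A := A) (q₀ := q₀) (fun q : F => rank q.1)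
      fun q o q' h => D.rank_le h
  · rintro rfl p γ a p' hδ
    refine ASM.toATM_δ_isE ?_ hδ
    rintro ⟨q, hq⟩ o ⟨q', hq'⟩ (h : D.Rule q o q')
    change D.isE q = D.b
    cases h with
    | guess m =>
      obtain rfl : m = 0 := Nat.lt_one_iff.1 hq
      rfl
    | next m => exact absurd (Nat.lt_one_iff.1 hq) (Nat.succ_ne_zero m)
    | _ => rfl
  · rw [ATM.Accepts, ← ASM.Represents.accepted_iff (A.represents_init w)]
    rw [ASM.accepted_restrict D.toASM fun q o q' h hq => D.states_closed hN hS h hq]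
    have h := D.accepted_stage (k + 1) (w.map letter).reverse
    have h1 : Function.update (fun _ => []) none
        (w.map ⇑(letter.trans (Function.Embedding.inl (β := G)))).reverse =
        stk (K₀ := K₀) (w.map letter).reverse fun _ => [] := by
      rw [← update_stk_none [], List.map_reverse, List.map_map]
      congr 1
      funext i
      cases i <;> rfl
    rw [h1]
    exact h

end Guesser
end ATMPaper

namespace ATMPaper
open Turing ToPartrec PartrecToTM2

/-- The letters of level `j` in a string of letters with levels. -/
def levelPart {α : Type} {n : ℕ} (j : ℕ) (t : List (Fin n × α)) : List α :=
  t.filterMap fun x => if (x.1 : ℕ) = j then some x.2 else none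

section LevelPart

variable {α : Type} {n : ℕ}

theorem levelPart_append (j : ℕ) (s t : List (Fin n × α)) :
    levelPart j (s ++ t) = levelPart j s ++ levelPart j t :=
  List.filterMap_append

theorem levelPart_map_self (i : Fin n) (x : List α) :
    levelPart i (x.map fun a => (i, a)) = x := by
  simp [levelPart, List.filterMap_map]

theorem levelPart_map_of_ne {j : ℕ} {i : Fin n} (h : (i : ℕ) ≠ j) (x : List α) :
    levelPart j (x.map fun a => (i, a)) = [] := by
  simp [levelPart, List.filterMap_map, h]

theorem computable_levelParts [Primcodable α] (k : ℕ) :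
    Computable fun t : List (Fin n × α) =>
      ((levelPart k t).reverse, fun i : Fin k => levelPart (k - 1 - i) t) := by
  have h : Primrec₂ fun (j : ℕ) (t : List (Fin n × α)) => levelPart j t := by
    refine Primrec.listFilterMap Primrec.snd ?_
    refine Primrec.ite (Primrec.eq.comp ?_ ?_) ?_ (Primrec.const none)
    · exact Primrec.fin_val.comp (Primrec.fst.comp Primrec.snd)
    · exact Primrec.fst.comp Primrec.fst
    · exact Primrec.option_some.comp (Primrec.snd.comp Primrec.snd)
  refine (Primrec.pair ?_ ?_).to_comp
  · exact Primrec.list_reverse.comp (h.comp (.const k) .id)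
  · refine Primrec.fin_curry.2 (h.comp ?_ .fst)
    exact Primrec.nat_sub.comp (.const (k - 1)) (Primrec.fin_val.comp .snd)

end LevelPart

section Levels

variable {α K₀ G Λ σ : Type} {k : ℕ} (D : Guesser α (Fin (k + 1) × α) K₀ G Λ σ)

theorem levelPart_build_of_le
    (hD : ∀ m (h : m ≤ k) a, D.letter m a = (⟨m, Nat.lt_succ_of_le h⟩, a))
    {n : ℕ} (hn : n ≤ k) {j : ℕ} (hj : n ≤ j)
    (v : Fin n → List α) (t : List (Fin (k + 1) × α)) :
    levelPart j (D.build n v t) = levelPart j t := by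
  induction n generalizing t with
  | zero => rfl
  | succ n ih =>
    rw [Guesser.build, ih (by omega) (by omega), levelPart_append, funext (hD n (by omega)),
      levelPart_map_of_ne (by simp; omega), List.nil_append]

theorem levelPart_build
    (hD : ∀ m (h : m ≤ k) a, D.letter m a = (⟨m, Nat.lt_succ_of_le h⟩, a))
    {n : ℕ} (hn : n ≤ k) (v : Fin n → List α)
    {t : List (Fin (k + 1) × α)} (ht : ∀ j < n, levelPart j t = []) (i : Fin n) :
    levelPart (n - 1 - i) (D.build n v t) = v i := by
  induction n generalizing t with
  | zero => exact i.elim0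
  | succ n ih =>
    rw [Guesser.build]
    cases i using Fin.cases with
    | zero =>
      rw [levelPart_build_of_le D hD (by omega) (by simp), levelPart_append,
        funext (hD n (by omega))]
      have := levelPart_map_self (⟨n, by omega⟩ : Fin (k + 1)) (v 0)
      simp only [Nat.add_sub_cancel, Fin.val_zero, Nat.sub_zero, ht n (by omega),
        List.append_nil]
      exact this
    | succ i =>
      have := ih (by omega) (Fin.tail v) (t := (v 0).map (D.letter n) ++ t) (by
        intro j hj
        rw [levelPart_append, funext (hD n (by omega)), levelPart_map_of_ne (by simp; omega),
          ht j (by omega)]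
        rfl) i
      rw [show n + 1 - 1 - (i.succ : ℕ) = n - 1 - i by simp; omega]
      exact this

end Levels

theorem phaseType_eq {α Sy K₀ G Λ σ : Type} (D : Guesser α Sy K₀ G Λ σ) (m : ℕ) :
    D.phaseType m = Bool.not^[m] D.b := by
  induction m with
  | zero => rfl
  | succ m ih => rw [Guesser.phaseType, ih, Function.iterate_succ_apply']

/-- The guesser running the Turing machine of the code `c`. -/
def codeGuesser {α : Type} [Primcodable α] (k : ℕ) (b : Bool) (c : Code) :
    Guesser α (Fin (k + 1) × α) K' Γ' Λ' (Option Γ') where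
  b := b
  letter m a := (Fin.ofNat _ m, a)
  enc x := trNat (Encodable.encode x + 1) ++ [Γ'.cons]
  prog := tr
  main := K'.main
  l₀ := trNormal c Cont'.halt
  v₀ := none

section CodeGuesser

variable {α : Type} [Primcodable α] (k : ℕ) (b : Bool) (c : Code)

theorem codeGuesser_fed (t : List (Fin (k + 1) × α)) (l : List ℕ) :
    (codeGuesser (α := α) k b c).fed t (trList l) =
      trList ((t.reverse.map fun x => Encodable.encode x + 1) ++ l) := by
  induction t generalizing l with
  | nil => rfl
  | cons x t ih =>
    have := ih ((Encodable.encode x + 1) :: l)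
    simp only [trList] at this
    simpa [Guesser.fed, codeGuesser] using this

theorem codeGuesser_haltsOn (t : List (Fin (k + 1) × α)) :
    (codeGuesser (α := α) k b c).HaltsOn ((codeGuesser (α := α) k b c).fed t []) ↔
      (c.eval (t.reverse.map fun x => Encodable.encode x + 1)).Dom := by
  have h := codeGuesser_fed k b c t []
  rw [List.append_nil] at h
  have h0 : ∀ l, Function.update (fun _ => []) K'.main l = K'.elim l [] [] [] := by
    intro l
    funext i
    cases i <;> rfl
  change (codeGuesser (α := α) k b c).HaltsOn ((codeGuesser (α := α) k b c).fed t (trList [])) ↔ _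
  rw [h, Guesser.HaltsOn]
  have := tr_eval c (t.reverse.map fun x => Encodable.encode x + 1)
  simp only [codeGuesser, h0]
  change (StateTransition.eval (TM2.step tr) (init c _)).Dom ↔ _
  rw [this]
  rfl

end CodeGuesser

theorem exists_atm_of_computablePred {α : Type} [Fintype α] [Primcodable α] (k : ℕ) (b : Bool)
    {R : List α × (Fin (k + 1) → List α) → Prop} (hR : ComputablePred R) :
    ∃ (Γ : Type) (M : ATM α Γ), M.isE M.start = b ∧ M.AltBound (k + 1) ∧
      (k = 0 → ∀ q γ a q', M.δ q γ a q' → M.isE q = b) ∧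
      ∀ w, M.Accepts w ↔ AltQuant α (k + 1) b fun v => R (w, v) := by
  let e := Bool.not^[k] b
  let P : List (Fin (k + 2) × α) → Prop := fun s =>
    R ((levelPart (k + 1) s.reverse).reverse, fun i => levelPart (k - i) s.reverse)
  have hP : ComputablePred P :=
    ComputablePred.computable_iff.2 <| by
      obtain ⟨f, hf, rfl⟩ := ComputablePred.computable_iff.1 hR
      exact ⟨_, hf.comp ((computable_levelParts (k + 1)).comp Computable.list_reverse), rfl⟩
  obtain ⟨c, hc⟩ : ∃ c : Code, ∀ s : List (Fin (k + 2) × α),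
      ((c.eval (s.map fun a => Encodable.encode a + 1)).Dom ↔ e = true) ↔ P s := by
    cases he : e with
    | true =>
      obtain ⟨c, hc⟩ := exists_code_of_rePred hP.to_re
      exact ⟨c, fun s => by simp [hc]⟩
    | false =>
      obtain ⟨c, hc⟩ := exists_code_of_rePred hP.not.to_re
      exact ⟨c, fun s => by simp [hc]⟩
  let D : Guesser α (Fin (k + 2) × α) K' Γ' Λ' (Option Γ') := codeGuesser (k + 1) e c
  have hD : ∀ m (h : m ≤ k + 1) a, D.letter m a = (⟨m, Nat.lt_succ_of_le h⟩, a) := by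
    intro m h a
    refine Prod.ext (Fin.ext ?_) rfl
    exact Nat.mod_eq_of_lt (Nat.lt_succ_of_le h)
  have hb : D.phaseType k = b := by
    rw [phaseType_eq]
    change Bool.not^[k] (Bool.not^[k] b) = b
    rw [← Function.iterate_add_apply, Function.Involutive.iterate_even Bool.not_not ⟨k, rfl⟩]
    rfl
  have : Finite K' := Finite.of_surjective
    (fun i : Fin 4 => ![K'.main, K'.rev, K'.aux, K'.stack] i) fun x => by
      cases x
      exacts [⟨0, rfl⟩, ⟨1, rfl⟩, ⟨2, rfl⟩, ⟨3, rfl⟩]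
  let letter : α ↪ Fin (k + 2) × α := ⟨fun a => (Fin.last _, a), fun a b h => congrArg Prod.snd h⟩
  obtain ⟨Γ, M, h1, h2, h3, h4⟩ := D.exists_atm letter k (tr_supports c Cont'.halt)
  rw [hb] at h1
  refine ⟨Γ, M, h1, h2, ?_, fun w => ?_⟩
  · rintro rfl
    exact h3 rfl
  · rw [h4, hb]
    refine iff_of_eq (congrArg _ (funext fun v => propext ?_))
    change ((codeGuesser (k + 1) e c).HaltsOn ((codeGuesser (k + 1) e c).fed _ []) ↔ e = true) ↔ _
    rw [codeGuesser_haltsOn, hc]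
    have hw : ∀ j < k + 1, levelPart j (w.map letter).reverse = [] := by
      intro j hj
      rw [← List.map_reverse]
      exact levelPart_map_of_ne (by simp; omega) _
    simp only [P, List.reverse_reverse]
    have hv := levelPart_build D hD le_rfl v hw
    have hl : levelPart (k + 1) (w.map letter).reverse = w.reverse := by
      rw [← List.map_reverse]
      exact levelPart_map_self (Fin.last (k + 1)) _
    rw [levelPart_build_of_le D hD le_rfl le_rfl, hl, List.reverse_reverse]
    exact iff_of_eq (congrArg (fun u => R (w, u)) (funext hv))

theorem altQuant_const {α : Type} (k : ℕ) (b : Bool) (p : Prop) :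
    AltQuant α k b (fun _ => p) ↔ p := by
  induction k generalizing b with
  | zero => cases b <;> rfl
  | succ k ih => cases b <;> simp [AltQuant, ih]

/-- The actions, coded by letters with two extra elements. -/
def codedAct {Γ : Type} : Option (Option Γ) → Act Γ
  | none => .left
  | some none => .right
  | some (some τ) => .write τ

theorem codedAct_surjective {Γ : Type} : Function.Surjective (codedAct (Γ := Γ))
  | .left => ⟨none, rfl⟩
  | .right => ⟨some none, rfl⟩
  | .write τ => ⟨some (some τ), rfl⟩

/-- The effect of a coded action. -/
def actStep {Γ : Type} (blank : Γ) (a : Option (Option Γ)) (t : Tape Γ) : Tape Γ :=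
  a.casesOn (t.1.reverse.casesOn t fun τ u => (u.reverse, τ, t.2.1 :: t.2.2)) fun a =>
    a.casesOn (t.2.2.casesOn (t.1 ++ [t.2.1], blank, []) fun τ v => (t.1 ++ [t.2.1], τ, v))
      fun τ => (t.1, τ, t.2.2)

theorem actStep_iff {Γ : Type} {blank : Γ} {a : Option (Option Γ)} {t t' : Tape Γ} :
    ActStep blank (codedAct a) t t' ↔ t' = actStep blank a t := by
  constructor
  · intro h
    generalize ha : codedAct a = a' at h
    obtain _ | _ | τ := a <;> cases h <;> simp_all [codedAct, actStep]
  · rintro rfl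
    obtain ⟨u, γ, v⟩ := t
    obtain _ | _ | τ := a
    · rcases List.eq_nil_or_concat' u with rfl | ⟨u, τ, rfl⟩
      · exact .bwdEnd γ v
      · simpa [actStep, codedAct] using ActStep.bwd u τ γ v
    · cases v with
      | nil => exact .fwdEnd u γ
      | cons τ v => exact .fwd u γ τ v
    · exact .write u γ τ v

theorem primrec_actStep {Γ : Type} [Primcodable Γ] (blank : Γ) : Primrec₂ (actStep blank) := by
  have ht : Primrec fun p : Option (Option Γ) × Tape Γ => p.2 := .snd
  have hl : Primrec fun p : Option (Option Γ) × Tape Γ => p.2.1 := Primrec.fst.comp ht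
  have hγ : Primrec fun p : Option (Option Γ) × Tape Γ => p.2.2.1 :=
    Primrec.fst.comp (Primrec.snd.comp ht)
  have hr : Primrec fun p : Option (Option Γ) × Tape Γ => p.2.2.2 :=
    Primrec.snd.comp (Primrec.snd.comp ht)
  have hl' : Primrec fun p : Option (Option Γ) × Tape Γ => p.2.1 ++ [p.2.2.1] :=
    Primrec.list_append.comp hl (Primrec.list_cons.comp hγ (.const []))
  refine Primrec.option_casesOn .fst ?_ (Primrec.option_casesOn .snd ?_ ?_)
  · refine Primrec.list_casesOn
      (h := fun (p : Option (Option Γ) × Tape Γ) x => (x.2.reverse, x.1, p.2.2.1 :: p.2.2.2))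
      (Primrec.list_reverse.comp hl) ht ?_
    refine Primrec.pair ?_ ?_
    · exact Primrec.list_reverse.comp (Primrec.snd.comp .snd)
    · exact Primrec.pair (Primrec.fst.comp .snd)
        (Primrec.list_cons.comp (hγ.comp .fst) (hr.comp .fst))
  · refine Primrec.list_casesOn (hr.comp .fst) ((hl'.pair (.const (blank, []))).comp .fst) ?_
    exact Primrec.pair (hl'.comp (Primrec.fst.comp .fst)) .snd
  · exact Primrec.pair (hl.comp (Primrec.fst.comp .fst))
      (Primrec.pair .snd (hr.comp (Primrec.fst.comp .fst)))

namespace ATM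

variable {α Γ : Type} (M : ATM α Γ)

open Classical in
/-- Whether a coded transition is permitted by the machine, in a state of type `b`. -/
noncomputable def permits (b : Bool) (x : (M.Q × Γ) × Option (Option Γ) × M.Q) : Bool :=
  decide (M.isE x.1.1 = b ∧ M.δ x.1.1 x.1.2 (codedAct x.2.1) x.2.2)

theorem permits_iff {b : Bool} {x : (M.Q × Γ) × Option (Option Γ) × M.Q} :
    M.permits b x = true ↔ M.isE x.1.1 = b ∧ M.δ x.1.1 x.1.2 (codedAct x.2.1) x.2.2 := by
  simp [permits]

/-- One step from a configuration of type `b`, following a coded transition. -/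
noncomputable def stepBy (b : Bool) (c : M.Cfg) (a : Option (Option Γ) × M.Q) : Option M.Cfg :=
  bif M.permits b ((c.1, c.2.2.1), a) then some (a.2, actStep M.blank a.1 c.2) else none

theorem exists_stepBy_iff {b : Bool} {c c' : M.Cfg} :
    (∃ a, M.stepBy b c a = some c') ↔ M.cfgE c = b ∧ M.Yield c c' := by
  constructor
  · rintro ⟨a, h⟩
    rw [stepBy, Bool.cond_eq_ite, Option.ite_none_right_eq_some] at h
    obtain ⟨h, h'⟩ := h
    obtain rfl := Option.some.inj h'
    obtain ⟨hb, hδ⟩ := M.permits_iff.1 h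
    exact ⟨hb, _, hδ, actStep_iff.2 rfl⟩
  · rintro ⟨hb, a, hδ, hs⟩
    obtain ⟨a, rfl⟩ := codedAct_surjective a
    refine ⟨(a, c'.1), ?_⟩
    have h : M.permits b ((c.1, c.2.2.1), (a, c'.1)) = true := M.permits_iff.2 ⟨hb, hδ⟩
    rw [stepBy, h, cond_true, ← actStep_iff.1 hs]

/-- The configuration reached by following coded transitions from configurations of type `b`. -/
noncomputable def runBy (b : Bool) (c : M.Cfg) (l : List (Option (Option Γ) × M.Q)) :
    Option M.Cfg :=
  l.foldl (fun o a => o.bind fun c => M.stepBy b c a) (some c)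

theorem exists_runBy_iff {b : Bool} {c c' : M.Cfg} :
    (∃ l, M.runBy b c l = some c') ↔ TChain M.cfgE M.Yield b c c' := by
  constructor
  · rintro ⟨l, h⟩
    induction l using List.reverseRecOn generalizing c' with
    | nil =>
      obtain rfl := Option.some.inj h
      exact .refl
    | append_singleton l a ih =>
      rw [runBy, List.foldl_append, List.foldl_cons, List.foldl_nil,
        Option.bind_eq_some_iff] at h
      obtain ⟨c₁, h1, h2⟩ := h
      exact (ih h1).tail (M.exists_stepBy_iff.1 ⟨a, h2⟩)
  · intro h
    induction h with
    | refl => exact ⟨[], rfl⟩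
    | tail _ hs ih =>
      obtain ⟨l, hl⟩ := ih
      obtain ⟨a, ha⟩ := M.exists_stepBy_iff.2 hs
      refine ⟨l ++ [a], ?_⟩
      rw [runBy] at hl ⊢
      rw [List.foldl_append, hl]
      exact ha

variable [Primcodable Γ] [Primcodable M.Q]

/-- The pivot coded by a number, if there is one. -/
noncomputable def pivotBy (b : Bool) (c : M.Cfg) (n : ℕ) : Option M.Cfg :=
  ((Encodable.decode n).bind (M.runBy b c)).bind fun d => bif M.isE d.1 == !b then some d else none

theorem exists_pivotBy_iff {b : Bool} {c c' : M.Cfg} :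
    (∃ n, M.pivotBy b c n = some c') ↔ TPivot M.cfgE M.Yield b c c' := by
  rw [TPivot, ← exists_runBy_iff]
  constructor
  · rintro ⟨n, h⟩
    rw [pivotBy, Option.bind_eq_some_iff] at h
    obtain ⟨c₁, h1, h2⟩ := h
    obtain ⟨l, -, h1⟩ := Option.bind_eq_some_iff.1 h1
    rw [Bool.cond_eq_ite, Option.ite_none_right_eq_some] at h2
    obtain ⟨h2, h3⟩ := h2
    obtain rfl := Option.some.inj h3
    exact ⟨⟨l, h1⟩, eq_of_beq h2⟩
  · rintro ⟨⟨l, h⟩, hc⟩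
    refine ⟨Encodable.encode l, ?_⟩
    have hc : M.isE c'.1 = !b := hc
    simp [pivotBy, h, hc]

/-- Acceptance of configurations of type `b` with at most `k` alternations, given witnesses for
the quantifiers. -/
noncomputable def acceptsBy : (k : ℕ) → Bool → M.Cfg → (Fin k → List α) → Bool
  | 0, b, _, _ => !b
  | k + 1, b, c, v =>
    (M.pivotBy b c (v 0).length).casesOn (!b) fun c' => acceptsBy k (!b) c' fun i => v i.succ

theorem accepted_iff_altQuant [Nonempty α] {k : ℕ} {b : Bool} {c : M.Cfg} (hb : M.cfgE c = b)
    (hk : AltBoundFrom M.cfgE M.Yield k c) :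
    M.Accepted c ↔ AltQuant α k b fun v => M.acceptsBy k b c v = true := by
  have hlen : ∀ n : ℕ, ∃ x : List α, x.length = n := fun n =>
    ⟨List.replicate n (Classical.arbitrary α), List.length_replicate⟩
  induction k generalizing b c with
  | zero =>
    cases b with
    | true =>
      rw [Accepted, accepted_of_true hb]
      simp only [acceptsBy, AltQuant]
      exact ⟨fun ⟨c', hp, _⟩ => absurd hp (hk.not_pivot hb), nofun⟩
    | false =>
      rw [Accepted, accepted_of_false hb]
      exact ⟨fun _ => rfl, fun _ c' hp => absurd hp (hk.not_pivot hb)⟩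
  | succ k ih =>
    cases b with
    | true =>
      rw [Accepted, accepted_of_true hb, AltQuant]
      constructor
      · rintro ⟨c', hp, hc'⟩
        obtain ⟨n, hn⟩ := M.exists_pivotBy_iff.2 hp
        obtain ⟨x, rfl⟩ := hlen n
        refine ⟨x, ?_⟩
        simp only [acceptsBy, Fin.cons_zero, Fin.cons_succ, hn]
        exact (ih hp.2 (hk.pivot hb hp)).1 hc'
      · rintro ⟨x, hx⟩
        simp only [acceptsBy, Fin.cons_zero, Fin.cons_succ] at hx
        cases hn : M.pivotBy true c x.length with
        | none => simp [hn, altQuant_const] at hx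
        | some c' =>
          have hp := M.exists_pivotBy_iff.1 ⟨_, hn⟩
          simp only [hn] at hx
          exact ⟨c', hp, (ih hp.2 (hk.pivot hb hp)).2 hx⟩
    | false =>
      rw [Accepted, accepted_of_false hb, AltQuant]
      constructor
      · intro h x
        simp only [acceptsBy, Fin.cons_zero, Fin.cons_succ]
        cases hn : M.pivotBy false c x.length with
        | none => simp [altQuant_const]
        | some c' =>
          have hp := M.exists_pivotBy_iff.1 ⟨_, hn⟩
          exact (ih hp.2 (hk.pivot hb hp)).1 (h c' hp)
      · intro h c' hp
        obtain ⟨n, hn⟩ := M.exists_pivotBy_iff.2 hp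
        obtain ⟨x, rfl⟩ := hlen n
        have hx := h x
        simp only [acceptsBy, Fin.cons_zero, Fin.cons_succ, hn] at hx
        exact (ih hp.2 (hk.pivot hb hp)).2 hx

theorem primrec_init [Primcodable α] [Finite α] : Primrec M.init := by
  refine Primrec.pair (.const _) (Primrec.pair (.const _) (Primrec.pair (.const _) ?_))
  exact Primrec.list_map .id ((Primrec.dom_finite M.emb).comp .snd)

variable [Finite Γ] [Finite M.Q]

theorem primrec_stepBy (b : Bool) : Primrec₂ (M.stepBy b) := by
  refine Primrec.cond ((Primrec.dom_finite (M.permits b)).comp ?_) ?_ (.const none)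
  · refine Primrec.pair (Primrec.pair (Primrec.fst.comp .fst) ?_) .snd
    exact Primrec.fst.comp (Primrec.snd.comp (Primrec.snd.comp .fst))
  · refine Primrec.option_some.comp (Primrec.pair (Primrec.snd.comp .snd) ?_)
    exact (primrec_actStep M.blank).comp (Primrec.fst.comp .snd) (Primrec.snd.comp .fst)

theorem primrec_runBy (b : Bool) : Primrec₂ (M.runBy b) := by
  refine Primrec.list_foldl (f := fun p : M.Cfg × List (Option (Option Γ) × M.Q) => p.2)
    (h := fun _ x => x.1.bind fun c => M.stepBy b c x.2)
    .snd (Primrec.option_some.comp .fst) ?_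
  refine Primrec.option_bind (Primrec.fst.comp .snd) ?_
  exact (M.primrec_stepBy b).comp .snd (Primrec.snd.comp (Primrec.snd.comp .fst))

theorem primrec_pivotBy (b : Bool) : Primrec₂ (M.pivotBy b) := by
  refine Primrec.option_bind (Primrec.option_bind (Primrec.decode.comp .snd) ?_) ?_
  · exact (M.primrec_runBy b).comp (Primrec.fst.comp .fst) .snd
  · refine Primrec.cond ?_ (Primrec.option_some.comp .snd) (.const none)
    exact (Primrec.dom_finite fun q => M.isE q == !b).comp (Primrec.fst.comp .snd)

variable [Primcodable α]

theorem primrec_acceptsBy (k : ℕ) (b : Bool) : Primrec₂ (M.acceptsBy k b) := by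
  induction k generalizing b with
  | zero => exact .const _
  | succ k ih =>
    refine Primrec.option_casesOn ?_ (.const _) ?_
    · exact (M.primrec_pivotBy b).comp .fst
        (Primrec.list_length.comp (Primrec.fin_app.comp .snd (.const 0)))
    · refine (ih (!b)).comp .snd (Primrec.fin_curry.2 ?_)
      refine Primrec.fin_app.comp (Primrec.snd.comp (Primrec.fst.comp .fst)) ?_
      exact (Primrec.dom_finite Fin.succ).comp .snd

end ATM

theorem Finite.exists_primcodable (β : Type) [Finite β] : Nonempty (Primcodable β) := by
  obtain ⟨n, ⟨e⟩⟩ := Finite.exists_equiv_fin β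
  exact ⟨Primcodable.ofEquiv (Fin n) e⟩

theorem ATM.exists_computablePred {α Γ : Type} [Fintype α] [Primcodable α] (M : ATM α Γ)
    {k : ℕ} (hk : M.AltBound k) : ∃ R : List α × (Fin k → List α) → Prop, ComputablePred R ∧
      ∀ w, M.Accepts w ↔ AltQuant α k (M.isE M.start) fun v => R (w, v) := by
  rcases isEmpty_or_nonempty α with hα | hα
  · refine ⟨fun _ => M.Accepts [], ComputablePred.computable_iff.2 ?_, fun w => ?_⟩
    · by_cases h : M.Accepts []
      · exact ⟨fun _ => true, .const _, by simp [h]⟩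
      · exact ⟨fun _ => false, .const _, by simp [h]⟩
    · rw [altQuant_const, Subsingleton.elim w []]
  · have := M.ΓFin
    have := M.QFin
    obtain ⟨_⟩ := Finite.exists_primcodable Γ
    obtain ⟨_⟩ := Finite.exists_primcodable M.Q
    refine ⟨fun p => M.acceptsBy k (M.isE M.start) (M.init p.1) p.2 = true,
      ComputablePred.computable_iff.2 ⟨_, ?_, rfl⟩, fun w => ?_⟩
    · exact ((M.primrec_acceptsBy k _).comp (M.primrec_init.comp .fst) .snd).to_comp
    · exact M.accepted_iff_altQuant rfl (hk w)

end ATMPaper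

open ATMPaper in
/-- for every `k ≥ 1`, a language `L ⊆ Σ*` is `Σ⁰_k` iff
`L = L(M)` for some `Σ_k` ATM `M`, and `L` is `Π⁰_k` iff `L = L(M)` for some
`Π_k` ATM `M`. -/
theorem stmt13 {α : Type} [Fintype α] [Primcodable α] (k : ℕ) (hk : 1 ≤ k)
    (L : Set (List α)) :
    (IsSigma0 α k L ↔ ∃ (Γ : Type) (M : ATM α Γ), M.IsSigmaM k ∧ L = M.Lang) ∧
    (IsPi0 α k L ↔ ∃ (Γ : Type) (M : ATM α Γ), M.IsPiM k ∧ L = M.Lang) := by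
  obtain ⟨k, rfl⟩ : ∃ j, k = j + 1 := ⟨k - 1, by omega⟩
  refine ⟨⟨?_, ?_⟩, ?_, ?_⟩
  · rintro ⟨R, hR, rfl⟩
    obtain ⟨Γ, M, h₁, h₂, -, h₄⟩ := exists_atm_of_computablePred k true hR
    exact ⟨Γ, M, ⟨h₁, h₂⟩, Set.ext fun w => (h₄ w).symm⟩
  · rintro ⟨Γ, M, ⟨h₁, h₂⟩, rfl⟩
    obtain ⟨R, hR, h⟩ := M.exists_computablePred h₂
    rw [h₁] at h
    exact ⟨R, hR, Set.ext h⟩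
  · rintro ⟨R, hR, rfl⟩
    obtain ⟨Γ, M, h₁, h₂, h₃, h₄⟩ := exists_atm_of_computablePred k false hR
    exact ⟨Γ, M, ⟨h₁, h₂, fun h => h₃ (by omega)⟩, Set.ext fun w => (h₄ w).symm⟩
  · rintro ⟨Γ, M, ⟨h₁, h₂, -⟩, rfl⟩
    obtain ⟨R, hR, h⟩ := M.exists_computablePred h₂
    rw [h₁] at h
    exact ⟨R, hR, Set.ext h⟩
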